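/- arXiv:1609.09319 — 9 statements merged into one kernel-verified Lean document; each statement's English description precedes it below -/
import Mathlib

section
/- Let r and s be positive integers, let α = (α_1,…,α_r) and β = (β_1,…,β_s) with all α_i, β_j ∈ ℚ∖ℤ_{≤0}, and let p be a prime with p > max(M_{α,β}, 3·s·d_{α,β}). If r < s, then F_{α,β}(z) ∉ ℤ_p[[z]]; that is, there exists a nonnegative integer n such that v_p((α_1)_n⋯(α_r)_n/((β_1)_n⋯(β_s)_n)) < 0. -/
open scoped BigOperators

noncomputable section

/-- `hfrac x` is `⟨x⟩`, the unique element of `(0,1]` with `x - ⟨x⟩ ∈ ℤ`. -/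
def hfrac (x : ℝ) : ℝ := x - ⌈x⌉ + 1

/-- Christol's total order `≼` on `ℝ`. -/
def cle (x y : ℝ) : Prop := hfrac x < hfrac y ∨ (hfrac x = hfrac y ∧ y ≤ x)

/-- `d_{α,β}`: the lcm of the exact denominators of the components of `α` and `β`. -/
def dab {r s : ℕ} (α : Fin r → ℚ) (β : Fin s → ℚ) : ℕ :=
  Nat.lcm (Finset.univ.lcm fun i => (α i).den) (Finset.univ.lcm fun j => (β j).den)

/-- The coefficients of the hypergeometric series `F_{α,β}`. -/
def hgCoeff {r s : ℕ} (α : Fin r → ℚ) (β : Fin s → ℚ) (n : ℕ) : ℚ :=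
  (∏ i, (ascPochhammer ℚ n).eval (α i)) / (∏ j, (ascPochhammer ℚ n).eval (β j))

namespace padicValRat

variable {p : ℕ} [hp : Fact p.Prime]

theorem finset_prod {ι : Type*} (t : Finset ι) (f : ι → ℚ) (hf : ∀ i ∈ t, f i ≠ 0) :
    padicValRat p (∏ i ∈ t, f i) = ∑ i ∈ t, padicValRat p (f i) := by
  classical
  induction t using Finset.induction_on with
  | empty => simp
  | insert a t ha ih =>
    have ht : ∀ i ∈ t, f i ≠ 0 := fun i hi => hf i (Finset.mem_insert_of_mem hi)
    rw [Finset.prod_insert ha, Finset.sum_insert ha,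
      padicValRat.mul (hf a (Finset.mem_insert_self a t)) (Finset.prod_ne_zero_iff.2 ht), ih ht]

end padicValRat

/-- An arithmetic progression of length `p` with difference prime to `p` meets the multiples of
`p` exactly once. -/
theorem exists_unique_dvd_add_mul {p : ℕ} (hp : p.Prime) (a : ℤ) {d : ℕ} (hd : ¬p ∣ d) :
    ∃ k₀ < p, ∀ k < p, (p : ℤ) ∣ a + k * d ↔ k = k₀ := by
  have : Fact p.Prime := ⟨hp⟩
  have hd' : (d : ZMod p) ≠ 0 := by rwa [Ne, ZMod.natCast_eq_zero_iff]
  refine ⟨(-(a : ZMod p) / d).val, ZMod.val_lt _, fun k hk => ?_⟩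
  rw [← ZMod.intCast_zmod_eq_zero_iff_dvd]
  push_cast
  constructor
  · intro h
    have : -(a : ZMod p) / d = k := by
      rw [div_eq_iff hd']
      linear_combination -h
    rw [this, ZMod.val_cast_of_lt hk]
  · rintro rfl
    rw [ZMod.natCast_zmod_val, div_mul_cancel₀ _ hd', add_neg_cancel]

theorem ascPochhammer_eval_ne_zero {x : ℚ} (hx : ∀ m : ℤ, m ≤ 0 → x ≠ m) (n : ℕ) :
    (ascPochhammer ℚ n).eval x ≠ 0 := by
  rw [Ne, ascPochhammer_eval_eq_zero_iff]
  rintro ⟨k, -, hk⟩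
  exact hx (-k) (by omega) (by push_cast; linarith)

theorem ascPochhammer_eval_eq_prod_add (x : ℚ) (n : ℕ) :
    (ascPochhammer ℚ n).eval x = ∏ k ∈ Finset.range n, (x + k) := by
  induction n with
  | zero => simp
  | succ n ih => rw [ascPochhammer_succ_eval, Finset.prod_range_succ, ih]

/-- For `p` large with respect to `x`, the Pochhammer symbol `(x)_p` has `p`-adic valuation `1`. -/
theorem padicValRat_ascPochhammer_eval_self {p : ℕ} (hp : p.Prime) {x : ℚ}
    (hx : ∀ m : ℤ, m ≤ 0 → x ≠ m) (hpx : (x.den : ℚ) * (2 + 2 * |x|) < p) :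
    padicValRat p ((ascPochhammer ℚ p).eval x) = 1 := by
  have : Fact p.Prime := ⟨hp⟩
  have hden : (0 : ℚ) < x.den := by exact_mod_cast x.den_pos
  have hnum : (x.num : ℚ) = x.den * x := by rw [mul_comm, Rat.mul_den_eq_num]
  have habs : 0 ≤ (x.den : ℚ) * |x| := by positivity
  have hdp : (2 * x.den : ℚ) < p := by linarith
  have hpd : ¬p ∣ x.den := fun h => by
    have h₁ : (p : ℚ) ≤ x.den := by exact_mod_cast Nat.le_of_dvd x.den_pos h
    linarith
  have hne : ∀ k : ℕ, x + k ≠ 0 := fun k hk =>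
    hx (-k) (by omega) (by push_cast; linarith)
  have hcast : ∀ k : ℕ, ((x.num + k * x.den : ℤ) : ℚ) = x.den * (x + k) := fun k => by
    push_cast
    rw [hnum]
    ring
  have hne' : ∀ k : ℕ, x.num + k * (x.den : ℤ) ≠ 0 := fun k hk => by
    have := hcast k
    rw [hk, Int.cast_zero, eq_comm] at this
    exact mul_ne_zero hden.ne' (hne k) this
  have hval : ∀ k : ℕ, padicValRat p (x + k) = padicValInt p (x.num + k * x.den) := fun k => by
    rw [← padicValRat.of_int, hcast, padicValRat.mul hden.ne' (hne k), padicValRat.of_nat,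
      padicValNat.eq_zero_of_not_dvd hpd]
    simp
  obtain ⟨k₀, hk₀, hk₀'⟩ := exists_unique_dvd_add_mul hp x.num hpd
  rw [ascPochhammer_eval_eq_prod_add, padicValRat.finset_prod _ _ fun k _ => hne k,
    Finset.sum_eq_single_of_mem k₀ (Finset.mem_range.2 hk₀), hval]
  · have h₁ : 1 ≤ padicValInt p (x.num + k₀ * x.den) := by
      have := (padicValInt_dvd_iff (p := p) 1 (x.num + k₀ * x.den)).1
        (by simpa using (hk₀' k₀ hk₀).2 rfl)
      exact this.resolve_left (hne' k₀)
    have h₂ : ¬2 ≤ padicValInt p (x.num + k₀ * x.den) := fun h => by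
      have hdvd := (padicValInt_dvd_iff (p := p) 2 (x.num + k₀ * x.den)).2 (Or.inr h)
      have hle := Int.le_of_dvd (abs_pos.2 (hne' k₀)) ((dvd_abs _ _).2 hdvd)
      have hle' : (p : ℚ) ^ 2 ≤ |((x.num + k₀ * x.den : ℤ) : ℚ)| := by exact_mod_cast hle
      rw [hcast, abs_mul, abs_of_pos hden] at hle'
      have htri : |x + k₀| ≤ |x| + p := by
        refine (abs_add_le _ _).trans ?_
        rw [Nat.abs_cast]
        have : (k₀ : ℚ) ≤ p := by exact_mod_cast hk₀.le
        linarith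
      have hp1 : (1 : ℚ) < p := by exact_mod_cast hp.one_lt
      nlinarith [mul_le_mul_of_nonneg_left htri hden.le]
    omega
  · intro k hk hkk
    rw [hval, padicValInt.eq_zero_of_not_dvd fun h =>
      hkk ((hk₀' k (Finset.mem_range.1 hk)).1 h), Nat.cast_zero]

theorem padicValRat_prod_ascPochhammer_eval_self {p n : ℕ} (hp : p.Prime) {x : Fin n → ℚ}
    (hx : ∀ i, ∀ m : ℤ, m ≤ 0 → x i ≠ m) (hpx : ∀ i, ((x i).den : ℚ) * (2 + 2 * |x i|) < p) :
    padicValRat p (∏ i, (ascPochhammer ℚ p).eval (x i)) = n := by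
  have : Fact p.Prime := ⟨hp⟩
  rw [padicValRat.finset_prod _ _ fun i _ => ascPochhammer_eval_ne_zero (hx i) p]
  simp [padicValRat_ascPochhammer_eval_self hp (hx _) (hpx _)]

theorem dab_pos {r s : ℕ} (α : Fin r → ℚ) (β : Fin s → ℚ) : 0 < dab α β := by
  refine Nat.lcm_pos ?_ ?_ <;> refine Nat.pos_of_ne_zero fun h => ?_ <;>
    simp [Finset.lcm_eq_zero_iff] at h

theorem den_left_le_dab {r s : ℕ} (α : Fin r → ℚ) (β : Fin s → ℚ) (i : Fin r) :
    (α i).den ≤ dab α β :=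
  Nat.le_of_dvd (dab_pos α β) <|
    (Finset.dvd_lcm (f := fun i => (α i).den) (Finset.mem_univ i)).trans (Nat.dvd_lcm_left _ _)

theorem den_right_le_dab {r s : ℕ} (α : Fin r → ℚ) (β : Fin s → ℚ) (j : Fin s) :
    (β j).den ≤ dab α β :=
  Nat.le_of_dvd (dab_pos α β) <|
    (Finset.dvd_lcm (f := fun j => (β j).den) (Finset.mem_univ j)).trans (Nat.dvd_lcm_right _ _)

/-- Theorem 1.2(i): if `r < s` and `p > max(M_{α,β}, 3 s d_{α,β})` is prime, then
`F_{α,β}(z) ∉ ℤ_p[[z]]`, i.e. some coefficient has negative `p`-adic valuation.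
The hypothesis `p > M_{α,β} = d_{α,β}(2 + 2 max_{i,j}{|α_i|,|β_j|})` is expressed
componentwise. -/
theorem stmt0 {r s : ℕ} (hr : 0 < r) (hs : 0 < s)
    (α : Fin r → ℚ) (β : Fin s → ℚ)
    (hα : ∀ i, ∀ m : ℤ, m ≤ 0 → α i ≠ (m : ℚ))
    (hβ : ∀ j, ∀ m : ℤ, m ≤ 0 → β j ≠ (m : ℚ))
    (p : ℕ) (hp : p.Prime)
    (hpM : ∀ i, (p : ℚ) > (dab α β : ℚ) * (2 + 2 * |α i|))
    (hpM' : ∀ j, (p : ℚ) > (dab α β : ℚ) * (2 + 2 * |β j|))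
    (hps : (p : ℚ) > 3 * s * (dab α β : ℚ))
    (hrs : r < s) :
    ∃ n : ℕ, padicValRat p (hgCoeff α β n) < 0 := by
  have : Fact p.Prime := ⟨hp⟩
  refine ⟨p, ?_⟩
  have hα' : ∀ i, ((α i).den : ℚ) * (2 + 2 * |α i|) < p := fun i =>
    (mul_le_mul_of_nonneg_right (by exact_mod_cast den_left_le_dab α β i)
      (by positivity)).trans_lt (hpM i)
  have hβ' : ∀ j, ((β j).den : ℚ) * (2 + 2 * |β j|) < p := fun j =>
    (mul_le_mul_of_nonneg_right (by exact_mod_cast den_right_le_dab α β j)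
      (by positivity)).trans_lt (hpM' j)
  rw [hgCoeff, padicValRat.div
      (Finset.prod_ne_zero_iff.2 fun i _ => ascPochhammer_eval_ne_zero (hα i) p)
      (Finset.prod_ne_zero_iff.2 fun j _ => ascPochhammer_eval_ne_zero (hβ j) p),
    padicValRat_prod_ascPochhammer_eval_self hp hα hα',
    padicValRat_prod_ascPochhammer_eval_self hp hβ hβ']
  omega
end
end

section
/- Let r and s be positive integers, let α = (α_1,…,α_r) and β = (β_1,…,β_s) with all α_i, β_j ∈ ℚ∖ℤ_{≤0}, let p be a prime with p > max(M_{α,β}, 3·s·d_{α,β}), and let a be the integer with 1 ≤ a ≤ d_{α,β} and a·p ≡ 1 (mod d_{α,β}). If r > s, then F_{α,β}(z) ∈ ℤ_p[[z]] if and only if δ_{α,β}(x, a) ≥ 0 for every x ∈ ℝ. -/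
open scoped BigOperators

noncomputable section

/-- The Christol function `δ_{α,β}(x, a)`. -/
def christol {r s : ℕ} (α : Fin r → ℚ) (β : Fin s → ℚ) (x : ℝ) (a : ℕ) : ℤ :=
  (Nat.card {i : Fin r // cle ((a : ℝ) * (α i : ℝ)) x} : ℤ)
    - (Nat.card {j : Fin s // cle ((a : ℝ) * (β j : ℝ)) x} : ℤ)

open Filter Finset

theorem eventually_padicValRat_eq_card (p : ℕ) [hp : Fact p.Prime] {z : ℤ} (hz : z ≠ 0) :
    ∀ᶠ B in atTop,
      padicValRat p z = ∑ k ∈ Ico 1 B, if ((p ^ k : ℕ) : ℤ) ∣ z then (1 : ℤ) else 0 := by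
  have hz' : z.natAbs ≠ 0 := Int.natAbs_ne_zero.2 hz
  filter_upwards [eventually_gt_atTop (Nat.log p z.natAbs)] with B hB
  have h := Nat.emultiplicity_eq_card_pow_dvd hp.out.ne_one (Nat.pos_of_ne_zero hz') hB
  rw [← padicValNat_eq_emultiplicity hz', Nat.cast_inj] at h
  rw [padicValRat.of_int, padicValInt, h, Finset.sum_boole]
  simp only [Int.natCast_dvd]

theorem pow_dvd_num_add_iff {p k t : ℕ} (hp : p.Prime) {γ : ℚ} (hden : ¬ p ∣ γ.den)
    (ht : ((p ^ k : ℕ) : ℤ) ∣ γ.num + t * γ.den) (n : ℕ) :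
    ((p ^ k : ℕ) : ℤ) ∣ γ.num + n * γ.den ↔ n ≡ t [MOD p ^ k] := by
  have hcop : IsCoprime ((p ^ k : ℕ) : ℤ) (γ.den : ℤ) :=
    Nat.isCoprime_iff_coprime.2 (((Nat.Prime.coprime_iff_not_dvd hp).2 hden).pow_left k)
  rw [Nat.ModEq.comm, Nat.modEq_iff_dvd, ← dvd_sub_left ht,
    show γ.num + n * γ.den - (γ.num + t * γ.den) = ((n : ℤ) - t) * γ.den by ring]
  exact ⟨hcop.dvd_of_dvd_mul_right, fun h => h.mul_right _⟩

theorem add_natCast_ne_zero_of_ne_nonpos {γ : ℚ} (hγ : ∀ m : ℤ, m ≤ 0 → γ ≠ m) (n : ℕ) :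
    γ + n ≠ 0 := fun h => hγ (-n) (by simp) (by push_cast; linarith)

theorem ascPochhammer_eval_ne_zero_of_ne_nonpos {γ : ℚ} (hγ : ∀ m : ℤ, m ≤ 0 → γ ≠ m) (n : ℕ) :
    (ascPochhammer ℚ n).eval γ ≠ 0 := by
  induction n with
  | zero => simp
  | succ n ih =>
    rw [ascPochhammer_succ_eval]
    exact mul_ne_zero ih (add_natCast_ne_zero_of_ne_nonpos hγ n)

theorem eventually_padicValRat_ascPochhammer (p : ℕ) [hp : Fact p.Prime] {γ : ℚ}
    (hγ : ∀ m : ℤ, m ≤ 0 → γ ≠ m) (hden : ¬ p ∣ γ.den) {t : ℕ → ℕ}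
    (ht : ∀ k, 1 ≤ k → ((p ^ k : ℕ) : ℤ) ∣ γ.num + t k * γ.den) (n : ℕ) :
    ∀ᶠ B in atTop, padicValRat p ((ascPochhammer ℚ n).eval γ) =
      ∑ k ∈ Ico 1 B, (n.count (· ≡ t k [MOD p ^ k]) : ℤ) := by
  induction n with
  | zero => simp
  | succ n ih =>
    have hne := add_natCast_ne_zero_of_ne_nonpos hγ n
    have hd : (γ.den : ℚ) ≠ 0 := by exact_mod_cast γ.den_ne_zero
    have hnum : (γ + n) * γ.den = ((γ.num + n * γ.den : ℤ) : ℚ) := by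
      push_cast
      rw [add_mul, Rat.mul_den_eq_num]
    have hz : γ.num + n * γ.den ≠ 0 := by
      intro h
      rw [h, Int.cast_zero] at hnum
      exact (mul_ne_zero hne hd) hnum
    have hval : padicValRat p (γ + n) = padicValRat p ((γ.num + n * γ.den : ℤ) : ℚ) := by
      rw [← hnum, padicValRat.mul hne hd, padicValRat.of_nat,
        padicValNat.eq_zero_of_not_dvd hden]
      simp
    filter_upwards [ih, eventually_padicValRat_eq_card p hz] with B h₁ h₂
    rw [ascPochhammer_succ_eval,
      padicValRat.mul (ascPochhammer_eval_ne_zero_of_ne_nonpos hγ n) hne, hval, h₁, h₂,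
      ← Finset.sum_add_distrib]
    refine Finset.sum_congr rfl fun k hk => ?_
    rw [Nat.count_succ]
    simp only [pow_dvd_num_add_iff hp.out hden (ht k (mem_Ico.1 hk).1)]
    push_cast
    rfl

/-- The rational version of `hfrac`. -/
def ratHfrac (x : ℚ) : ℚ := x - ⌈x⌉ + 1

theorem hfrac_ratCast (x : ℚ) : hfrac x = ratHfrac x := by
  simp [hfrac, ratHfrac]

theorem ratHfrac_pos (x : ℚ) : 0 < ratHfrac x := by
  have := Int.ceil_lt_add_one x
  unfold ratHfrac; linarith

theorem ratHfrac_le_one (x : ℚ) : ratHfrac x ≤ 1 := by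
  have := Int.le_ceil x
  unfold ratHfrac; linarith

theorem mul_ratHfrac_eq_int {d : ℤ} {x : ℚ} (hx : ∃ z : ℤ, d * x = z) :
    ∃ z : ℤ, d * ratHfrac x = z := by
  obtain ⟨z, hz⟩ := hx
  refine ⟨z - d * ⌈x⌉ + d, ?_⟩
  push_cast
  rw [← hz]; unfold ratHfrac; ring

/-- The conditions on a parameter `γ` under which its residues modulo powers of `p` are governed
by the fractional parts of `a ^ k * γ`. -/
structure IsSmallParam (p d a : ℕ) (γ : ℚ) : Prop where
  ne_nonpos : ∀ m : ℤ, m ≤ 0 → γ ≠ m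
  lt : (d : ℚ) * (2 + 2 * |γ|) < p
  den_dvd : γ.den ∣ d
  d_pos : 0 < d
  a_pos : 0 < a
  modEq : a * p ≡ 1 [MOD d]

/-- For a small parameter `γ`, the residue of `-γ` modulo `p ^ k`. -/
def negResidue (p a k : ℕ) (γ : ℚ) : ℕ := ⌊p ^ k * ratHfrac (a ^ k * γ) - γ⌋₊

namespace IsSmallParam

theorem exists_den_mul_eq {p d a : ℕ} {γ : ℚ} (h : IsSmallParam p d a γ) :
    ∃ z : ℤ, (d : ℚ) * γ = z := by
  obtain ⟨e, he⟩ := h.den_dvd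
  refine ⟨e * γ.num, ?_⟩
  rw [he]
  push_cast
  rw [← Rat.mul_den_eq_num]; ring

theorem not_dvd_den {p d a : ℕ} {γ : ℚ} (h : IsSmallParam p d a γ) (hp : p.Prime) :
    ¬ p ∣ γ.den := by
  intro hpd
  have h1 : a * p ≡ 1 [MOD p] := h.modEq.of_dvd (hpd.trans h.den_dvd)
  have h2 : p ∣ 1 := (h1.dvd_iff dvd_rfl).1 (Dvd.intro_left _ rfl)
  exact hp.one_lt.ne' (Nat.dvd_one.1 h2)

theorem exists_d_mul_ratHfrac_eq {p d a : ℕ} {γ : ℚ} (h : IsSmallParam p d a γ) (k : ℕ) :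
    ∃ z : ℤ, (d : ℚ) * ratHfrac (a ^ k * γ) = z := by
  obtain ⟨z, hz⟩ := h.exists_den_mul_eq
  refine mod_cast mul_ratHfrac_eq_int (d := d) ⟨a ^ k * z, ?_⟩
  push_cast
  rw [← hz]; ring

theorem one_le_d_mul_ratHfrac {p d a : ℕ} {γ : ℚ} (h : IsSmallParam p d a γ) (k : ℕ) :
    1 ≤ (d : ℚ) * ratHfrac (a ^ k * γ) := by
  obtain ⟨z, hz⟩ := h.exists_d_mul_ratHfrac_eq k
  have hd : (0 : ℚ) < d := by exact_mod_cast h.d_pos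
  have hpos := mul_pos hd (ratHfrac_pos (a ^ k * γ))
  rw [hz] at hpos ⊢
  exact_mod_cast (show (0 : ℤ) < z from by exact_mod_cast hpos)

theorem exists_sub_eq_int {p d a : ℕ} {γ : ℚ} (h : IsSmallParam p d a γ) (k : ℕ) :
    ∃ z : ℤ, (p : ℚ) ^ k * ratHfrac (a ^ k * γ) - γ = z := by
  obtain ⟨z, hz⟩ := h.exists_den_mul_eq
  have hmod : 1 ≡ (a * p) ^ k [MOD d] := by simpa using (h.modEq.pow k).symm
  obtain ⟨e, he⟩ := Nat.modEq_iff_dvd.1 hmod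
  have he' : ((a : ℚ) * p) ^ k - 1 = d * e := by exact_mod_cast he
  refine ⟨e * z + p ^ k * (1 - ⌈(a : ℚ) ^ k * γ⌉), ?_⟩
  push_cast
  rw [← hz]
  unfold ratHfrac
  rw [mul_pow] at he'
  linear_combination γ * he'

theorem lt_pow {p d a : ℕ} {γ : ℚ} (h : IsSmallParam p d a γ) (hp : p.Prime) {k : ℕ}
    (hk : 1 ≤ k) : (d : ℚ) * (2 + 2 * |γ|) < p ^ k :=
  h.lt.trans_le (le_self_pow₀ (by exact_mod_cast hp.one_lt.le) (by omega))

theorem natCast_negResidue {p d a : ℕ} {γ : ℚ} (h : IsSmallParam p d a γ) (hp : p.Prime) {k : ℕ}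
    (hk : 1 ≤ k) : (negResidue p a k γ : ℚ) = p ^ k * ratHfrac (a ^ k * γ) - γ := by
  obtain ⟨z, hz⟩ := h.exists_sub_eq_int k
  have hlow := h.one_le_d_mul_ratHfrac k
  have hd : (0 : ℚ) < d := by exact_mod_cast h.d_pos
  have hlt := h.lt_pow hp hk
  have hpk : (0 : ℚ) < p ^ k := pow_pos (by exact_mod_cast hp.pos) k
  have hnonneg : (0 : ℚ) ≤ z := by
    rw [← hz]
    have h1 : (p : ℚ) ^ k ≤ d * (p ^ k * ratHfrac (a ^ k * γ)) := by nlinarith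
    have h2 := lt_of_mul_lt_mul_left (hlt.trans_le h1) hd.le
    linarith [le_abs_self γ, abs_nonneg γ]
  have hz0 : 0 ≤ z := by exact_mod_cast hnonneg
  lift z to ℕ using hz0
  rw [negResidue, hz]
  simp

theorem pow_dvd_negResidue {p d a : ℕ} {γ : ℚ} (h : IsSmallParam p d a γ) (hp : p.Prime) {k : ℕ}
    (hk : 1 ≤ k) : ((p ^ k : ℕ) : ℤ) ∣ γ.num + negResidue p a k γ * γ.den := by
  obtain ⟨z, hz⟩ := mul_ratHfrac_eq_int (d := γ.den) (x := a ^ k * γ) ⟨a ^ k * γ.num, by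
    push_cast; rw [← Rat.mul_den_eq_num]; ring⟩
  refine ⟨z, ?_⟩
  have hγ := Rat.mul_den_eq_num γ
  have := h.natCast_negResidue hp hk
  qify
  push_cast at hz
  rw [this, ← hz]
  linear_combination -hγ

theorem negResidue_lt {p d a : ℕ} {γ : ℚ} (h : IsSmallParam p d a γ) (hp : p.Prime) {k : ℕ}
    (hk : 1 ≤ k) : negResidue p a k γ < p ^ k := by
  have ht := h.natCast_negResidue hp hk
  have hd : (0 : ℚ) < d := by exact_mod_cast h.d_pos
  have hlt := h.lt_pow hp hk
  have hpk : (0 : ℚ) < p ^ k := pow_pos (by exact_mod_cast hp.pos) k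
  qify
  rcases (ratHfrac_le_one (a ^ k * γ)).lt_or_eq with h1 | h1
  · obtain ⟨z, hz⟩ := h.exists_d_mul_ratHfrac_eq k
    have hzd : (z : ℚ) < d := by rw [← hz]; nlinarith
    have hzd' : (z : ℚ) + 1 ≤ d := by
      have : z < (d : ℤ) := by exact_mod_cast hzd
      exact_mod_cast this
    have h2 : (d : ℚ) * (p ^ k * ratHfrac (a ^ k * γ)) ≤ p ^ k * (d - 1) := by
      rw [mul_left_comm, hz]
      exact mul_le_mul_of_nonneg_left (by linarith) hpk.le
    refine lt_of_mul_lt_mul_left ?_ hd.le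
    rw [ht, mul_sub]
    nlinarith [neg_abs_le γ, abs_nonneg γ]
  · rw [h1, mul_one] at ht
    by_contra! hle
    refine h.ne_nonpos ((p : ℤ) ^ k - negResidue p a k γ) ?_ ?_
    · rw [sub_nonpos]; exact_mod_cast hle
    · push_cast; linarith

theorem pow_lt_d_mul_negResidue_add {p d a : ℕ} {γ : ℚ} (h : IsSmallParam p d a γ) (hp : p.Prime)
    {k : ℕ} (hk : 1 ≤ k) : p ^ k < d * negResidue p a k γ + p := by
  have ht := h.natCast_negResidue hp hk
  have hlow := h.one_le_d_mul_ratHfrac k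
  have hd : (0 : ℚ) < d := by exact_mod_cast h.d_pos
  have hpk : (0 : ℚ) < p ^ k := pow_pos (by exact_mod_cast hp.pos) k
  qify
  rw [ht]
  nlinarith [h.lt, le_abs_self γ, abs_nonneg γ]

theorem le_negResidue {p d a : ℕ} {γ : ℚ} (h : IsSmallParam p d a γ) (hp : p.Prime)
    {k : ℕ} (hk : 2 ≤ k) : p ≤ negResidue p a k γ := by
  have h1 := h.pow_lt_d_mul_negResidue_add hp (by omega : 1 ≤ k)
  have h2 : p ^ 2 ≤ p ^ k := Nat.pow_le_pow_right hp.pos hk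
  have h3 : 2 * d < p := by
    have := h.lt
    have hd : (0 : ℚ) < d := by exact_mod_cast h.d_pos
    have h4 : (2 * d : ℚ) < p := by nlinarith [abs_nonneg γ]
    exact_mod_cast h4
  by_contra! hlt
  have h5 : d * negResidue p a k γ ≤ d * p := Nat.mul_le_mul_left d hlt.le
  have := h.d_pos
  nlinarith

theorem negResidue_one_le_iff {p d a : ℕ} {γ γ' : ℚ} (h : IsSmallParam p d a γ)
    (h' : IsSmallParam p d a γ') (hp : p.Prime) :
    negResidue p a 1 γ ≤ negResidue p a 1 γ' ↔ cle ((a : ℝ) * γ) ((a : ℝ) * γ') := by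
  have ha : (0 : ℚ) < a := by exact_mod_cast h.a_pos
  have ht := h.natCast_negResidue hp le_rfl
  have ht' := h'.natCast_negResidue hp le_rfl
  have key : ∀ {x y : ℚ}, IsSmallParam p d a x → IsSmallParam p d a y →
      ratHfrac (a * x) < ratHfrac (a * y) → negResidue p a 1 x < negResidue p a 1 y := by
    intro x y hx hy hxy
    obtain ⟨u, hu⟩ := hx.exists_d_mul_ratHfrac_eq 1
    obtain ⟨v, hv⟩ := hy.exists_d_mul_ratHfrac_eq 1
    have hd : (0 : ℚ) < d := by exact_mod_cast h.d_pos
    rw [pow_one] at hu hv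
    have huv : (u : ℚ) + 1 ≤ v := by
      have : (u : ℚ) < v := by rw [← hu, ← hv]; exact mul_lt_mul_of_pos_left hxy hd
      exact_mod_cast this
    have hgap : (p : ℚ) ≤ d * (p * (ratHfrac (a * y) - ratHfrac (a * x))) := by
      have : (0 : ℚ) ≤ p := p.cast_nonneg
      nlinarith
    have hxs := hx.lt
    have hys := hy.lt
    have hsub : d * (y - x) < (p : ℚ) := by
      nlinarith [le_abs_self y, neg_abs_le x, abs_nonneg x, abs_nonneg y]
    have := lt_of_mul_lt_mul_left (hsub.trans_le hgap) hd.le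
    qify
    rw [hx.natCast_negResidue hp le_rfl, hy.natCast_negResidue hp le_rfl]
    simp only [pow_one]
    linarith
  have hcast : ∀ x : ℚ, hfrac ((a : ℝ) * x) = ratHfrac (a * x) := fun x => by
    rw [← hfrac_ratCast]; push_cast; rfl
  have hmul : (a : ℝ) * γ' ≤ (a : ℝ) * γ ↔ γ' ≤ γ := by
    rw [mul_le_mul_iff_right₀ (by exact_mod_cast ha)]; exact_mod_cast Iff.rfl
  rw [cle, hcast, hcast, hmul, Rat.cast_lt, Rat.cast_inj]
  rw [pow_one, pow_one] at ht ht'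
  rcases lt_trichotomy (ratHfrac (a * γ)) (ratHfrac (a * γ')) with hlt | heq | hgt
  · simp [hlt, (key h h' hlt).le]
  · rw [← heq] at ht'
    simp only [heq, lt_irrefl, false_or, true_and]
    qify
    rw [ht, ht']
    exact ⟨fun _ => by linarith, fun _ => by linarith⟩
  · simp [hgt.not_gt, hgt.ne', (key h' h hgt)]

end IsSmallParam

theorem cle_trans {x y z : ℝ} (hxy : cle x y) (hyz : cle y z) : cle x z := by
  unfold cle at *
  grind

theorem exists_threshold {ι : Type*} [Fintype ι] (t : ι → ℕ) (P : ι → Prop) {N : ℕ}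
    (hN : ∀ i, t i < N) (hP : ∀ i j, t i ≤ t j → P j → P i) :
    ∃ m ≤ N, ∀ i, P i ↔ t i < m := by
  classical
  refine ⟨(univ.filter P).sup fun i => t i + 1, Finset.sup_le fun i _ => hN i, fun i => ?_⟩
  rw [Finset.lt_sup_iff]
  constructor
  · exact fun hi => ⟨i, by simpa using hi, Nat.lt_succ_self _⟩
  · rintro ⟨j, hj, hij⟩
    exact hP i j (Nat.lt_succ_iff.1 hij) (by simpa using hj)

/-- The difference between the numbers of indices whose values under `u` and under `v` are below
the threshold `m`. -/
def countDiff {r s : ℕ} (u : Fin r → ℕ) (v : Fin s → ℕ) (m : ℕ) : ℤ :=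
  ((univ.filter fun i => u i < m).card : ℤ) - ((univ.filter fun j => v j < m).card : ℤ)

theorem christol_eq_countDiff {r s a m : ℕ} {α : Fin r → ℚ} {β : Fin s → ℚ} {x : ℝ}
    {u : Fin r → ℕ} {v : Fin s → ℕ} (hu : ∀ i, cle ((a : ℝ) * α i) x ↔ u i < m)
    (hv : ∀ j, cle ((a : ℝ) * β j) x ↔ v j < m) : christol α β x a = countDiff u v m := by
  simp only [christol, countDiff, hu, hv, Nat.card_eq_fintype_card, Fintype.card_subtype]

theorem christol_nonneg_iff {r s p d a : ℕ} {α : Fin r → ℚ} {β : Fin s → ℚ} (hp : p.Prime)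
    (hα : ∀ i, IsSmallParam p d a (α i)) (hβ : ∀ j, IsSmallParam p d a (β j)) :
    (∀ x : ℝ, 0 ≤ christol α β x a) ↔ ∀ m ≤ p,
      0 ≤ countDiff (fun i => negResidue p a 1 (α i)) (fun j => negResidue p a 1 (β j)) m := by
  have hγ : ∀ i, IsSmallParam p d a (Sum.elim α β i) := by
    rintro (i | j)
    exacts [hα i, hβ j]
  constructor
  · intro H m _
    by_cases hS : (univ.filter fun i => negResidue p a 1 (Sum.elim α β i) < m).Nonempty
    · obtain ⟨i₀, hi₀, hmax⟩ :=
        exists_max_image _ (fun i => negResidue p a 1 (Sum.elim α β i)) hS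
      have hiff : ∀ i, cle ((a : ℝ) * (Sum.elim α β i : ℚ)) ((a : ℝ) * (Sum.elim α β i₀ : ℚ)) ↔
          negResidue p a 1 (Sum.elim α β i) < m := fun i => by
        rw [← (hγ i).negResidue_one_le_iff (hγ i₀) hp]
        exact ⟨fun h => h.trans_lt (by simpa using hi₀), fun h => hmax i (by simpa using h)⟩
      exact (H _).trans_eq
        (christol_eq_countDiff (fun i => hiff (.inl i)) (fun j => hiff (.inr j)))
    · rw [not_nonempty_iff_eq_empty, filter_eq_empty_iff] at hS
      have h₁ := fun i => hS (mem_univ (.inl i))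
      have h₂ := fun j => hS (mem_univ (.inr j))
      simp only [Sum.elim_inl, Sum.elim_inr] at h₁ h₂
      simp [countDiff, h₁, h₂]
  · intro H x
    obtain ⟨m, hm, hiff⟩ := exists_threshold (fun i => negResidue p a 1 (Sum.elim α β i))
      (fun i => cle ((a : ℝ) * (Sum.elim α β i : ℚ)) x) (N := p)
      (fun i => by simpa using (hγ i).negResidue_lt hp le_rfl)
      (fun i j hij => cle_trans (((hγ i).negResidue_one_le_iff (hγ j) hp).1 hij))
    exact (H m hm).trans_eq
      (christol_eq_countDiff (fun i => hiff (.inl i)) (fun j => hiff (.inr j))).symm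

theorem count_modEq_of_le {n q t : ℕ} (hnq : n ≤ q) (htq : t < q) :
    n.count (· ≡ t [MOD q]) = if t < n then 1 else 0 := by
  rw [Nat.count_modEq_card _ (by omega), Nat.mod_eq_of_lt htq]
  rcases hnq.lt_or_eq with h | rfl
  · rw [Nat.div_eq_of_lt h, Nat.mod_eq_of_lt h, zero_add]
  · simp [htq, Nat.div_self (by omega : 0 < n)]

/-- The contribution of the modulus `p ^ k` to the `p`-adic valuation of `hgCoeff α β n`. -/
def levelVal {r s : ℕ} (α : Fin r → ℚ) (β : Fin s → ℚ) (p a n k : ℕ) : ℤ :=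
  (∑ i, (n.count (· ≡ negResidue p a k (α i) [MOD p ^ k]) : ℤ)) -
    ∑ j, (n.count (· ≡ negResidue p a k (β j) [MOD p ^ k]) : ℤ)

theorem eventually_padicValRat_prod_ascPochhammer {r p d a : ℕ} [hp : Fact p.Prime]
    {α : Fin r → ℚ} (hα : ∀ i, IsSmallParam p d a (α i)) (n : ℕ) :
    ∀ᶠ B in atTop, padicValRat p (∏ i, (ascPochhammer ℚ n).eval (α i)) =
      ∑ k ∈ Ico 1 B, ∑ i, (n.count (· ≡ negResidue p a k (α i) [MOD p ^ k]) : ℤ) := by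
  have hval : padicValRat p (∏ i, (ascPochhammer ℚ n).eval (α i)) =
      ∑ i, padicValRat p ((ascPochhammer ℚ n).eval (α i)) := by
    have key : ∀ S : Finset (Fin r), padicValRat p (∏ i ∈ S, (ascPochhammer ℚ n).eval (α i)) =
        ∑ i ∈ S, padicValRat p ((ascPochhammer ℚ n).eval (α i)) := by
      intro S
      induction S using Finset.cons_induction with
      | empty => simp
      | cons i S hi ih =>
        have hne := fun i => ascPochhammer_eval_ne_zero_of_ne_nonpos (hα i).ne_nonpos n
        rw [prod_cons, sum_cons, padicValRat.mul (hne i) (prod_ne_zero_iff.2 fun i _ => hne i), ih]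
    exact key univ
  filter_upwards [eventually_all.2 fun i => eventually_padicValRat_ascPochhammer p
    (hα i).ne_nonpos ((hα i).not_dvd_den hp.out)
    (fun k hk => (hα i).pow_dvd_negResidue hp.out hk) n] with B hB
  rw [hval, sum_comm]
  exact sum_congr rfl fun i _ => hB i

theorem eventually_padicValRat_hgCoeff {r s p d a : ℕ} [hp : Fact p.Prime]
    {α : Fin r → ℚ} {β : Fin s → ℚ} (hα : ∀ i, IsSmallParam p d a (α i))
    (hβ : ∀ j, IsSmallParam p d a (β j)) (n : ℕ) :
    ∀ᶠ B in atTop, padicValRat p (hgCoeff α β n) = ∑ k ∈ Ico 1 B, levelVal α β p a n k := by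
  filter_upwards [eventually_padicValRat_prod_ascPochhammer hα n,
    eventually_padicValRat_prod_ascPochhammer hβ n] with B h₁ h₂
  rw [hgCoeff, padicValRat.div, h₁, h₂, ← sum_sub_distrib]
  · rfl
  · exact prod_ne_zero_iff.2 fun i _ =>
      ascPochhammer_eval_ne_zero_of_ne_nonpos (hα i).ne_nonpos n
  · exact prod_ne_zero_iff.2 fun j _ =>
      ascPochhammer_eval_ne_zero_of_ne_nonpos (hβ j).ne_nonpos n

theorem levelVal_eq {r s p d a n k : ℕ} {α : Fin r → ℚ} {β : Fin s → ℚ} (hp : p.Prime)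
    (hα : ∀ i, IsSmallParam p d a (α i)) (hβ : ∀ j, IsSmallParam p d a (β j)) (hk : 1 ≤ k) :
    levelVal α β p a n k = ((n / p ^ k : ℕ) : ℤ) * ((r : ℤ) - s) +
      countDiff (fun i => negResidue p a k (α i)) (fun j => negResidue p a k (β j))
        (n % p ^ k) := by
  have hpk : 0 < p ^ k := pow_pos hp.pos k
  simp only [levelVal, countDiff, Nat.count_modEq_card _ hpk,
    Nat.mod_eq_of_lt ((hα _).negResidue_lt hp hk), Nat.mod_eq_of_lt ((hβ _).negResidue_lt hp hk),
    Nat.cast_add, sum_add_distrib, sum_const, card_univ, Fintype.card_fin, Nat.cast_ite,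
    Nat.cast_one, Nat.cast_zero, sum_boole, nsmul_eq_mul]
  ring

theorem levelVal_eq_countDiff {r s p d a n k : ℕ} {α : Fin r → ℚ} {β : Fin s → ℚ} (hp : p.Prime)
    (hα : ∀ i, IsSmallParam p d a (α i)) (hβ : ∀ j, IsSmallParam p d a (β j)) (hk : 1 ≤ k)
    (hn : n ≤ p ^ k) : levelVal α β p a n k =
      countDiff (fun i => negResidue p a k (α i)) (fun j => negResidue p a k (β j)) n := by
  simp only [levelVal, countDiff, count_modEq_of_le hn ((hα _).negResidue_lt hp hk),
    count_modEq_of_le hn ((hβ _).negResidue_lt hp hk), Nat.cast_ite, Nat.cast_one, Nat.cast_zero,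
    sum_boole]

theorem padicValRat_hgCoeff_of_le {r s p d a n : ℕ} [hp : Fact p.Prime] {α : Fin r → ℚ}
    {β : Fin s → ℚ} (hα : ∀ i, IsSmallParam p d a (α i)) (hβ : ∀ j, IsSmallParam p d a (β j))
    (hn : n ≤ p) : padicValRat p (hgCoeff α β n) =
      countDiff (fun i => negResidue p a 1 (α i)) (fun j => negResidue p a 1 (β j)) n := by
  obtain ⟨B, hB, h₂⟩ :=
    ((eventually_padicValRat_hgCoeff hα hβ n).and (eventually_ge_atTop 2)).exists
  rw [hB, sum_eq_sum_Ico_succ_bot h₂, levelVal_eq_countDiff hp.out hα hβ le_rfl (by simpa using hn),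
    sum_eq_zero, add_zero]
  intro k hk
  have hk2 : 2 ≤ k := (mem_Ico.1 hk).1
  rw [levelVal_eq_countDiff hp.out hα hβ (by omega)
    (hn.trans (Nat.le_self_pow (by omega) p))]
  have h₃ := fun i => (hn.trans ((hα i).le_negResidue hp.out hk2)).not_gt
  have h₄ := fun j => (hn.trans ((hβ j).le_negResidue hp.out hk2)).not_gt
  simp [countDiff, h₃, h₄]

theorem neg_le_countDiff {r s : ℕ} (u : Fin r → ℕ) (v : Fin s → ℕ) (m : ℕ) :
    -(s : ℤ) ≤ countDiff u v m := by
  have := card_filter_le (univ : Finset (Fin s)) fun j => v j < m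
  rw [card_univ, Fintype.card_fin] at this
  unfold countDiff
  omega

theorem mul_pred_le_div_of_levelVal_neg {r s p d a n k : ℕ} {α : Fin r → ℚ} {β : Fin s → ℚ}
    (hp : p.Prime) (hβ : ∀ j, IsSmallParam p d a (β j)) (hps : 3 * s * d < p) (hk : 2 ≤ k)
    (hneg : levelVal α β p a n k < 0) : s * (k - 1) ≤ n / p := by
  obtain ⟨j, hj⟩ : ∃ j, negResidue p a k (β j) < n := by
    by_contra! hle
    have hz : ∀ j, n.count (· ≡ negResidue p a k (β j) [MOD p ^ k]) = 0 := fun j => by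
      have hlt := (hβ j).negResidue_lt hp (by omega : 1 ≤ k)
      rw [count_modEq_of_le ((hle j).trans hlt.le) hlt, if_neg (hle j).not_gt]
    refine hneg.not_ge ?_
    simp only [levelVal, hz, Nat.cast_zero, sum_const_zero, sub_zero]
    positivity
  have hs : 1 ≤ s := Nat.one_le_iff_ne_zero.2 fun h => by subst h; exact j.elim0
  obtain ⟨l, rfl⟩ : ∃ l, k = l + 2 := ⟨k - 2, by omega⟩
  have h₁ := (hβ j).pow_lt_d_mul_negResidue_add hp (by omega : 1 ≤ l + 2)
  have hd := (hβ j).d_pos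
  have hl : l + 1 ≤ p ^ l := Nat.lt_pow_self hp.one_lt
  rw [show l + 2 - 1 = l + 1 by omega, Nat.le_div_iff_mul_le hp.pos]
  have h₂ : d * (3 * s * (l + 1) * p) ≤ p ^ (l + 2) := by
    calc d * (3 * s * (l + 1) * p) = (3 * s * d) * (l + 1) * p := by ring
      _ ≤ p * p ^ l * p := by gcongr
      _ = p ^ (l + 2) := by ring
  have h₃ : d * negResidue p a (l + 2) (β j) ≤ d * n := Nat.mul_le_mul_left d hj.le
  have h₄ : p ≤ d * (s * (l + 1) * p) :=
    Nat.le_mul_of_pos_left p (by positivity : 0 < d * (s * (l + 1))) |>.trans_eq (by ring)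
  refine Nat.le_of_mul_le_mul_left ?_ hd
  linarith

theorem padicValRat_hgCoeff_nonneg {r s p d a : ℕ} [hp : Fact p.Prime] {α : Fin r → ℚ}
    {β : Fin s → ℚ} (hα : ∀ i, IsSmallParam p d a (α i)) (hβ : ∀ j, IsSmallParam p d a (β j))
    (hps : 3 * s * d < p) (hrs : s < r)
    (h : ∀ m ≤ p,
      0 ≤ countDiff (fun i => negResidue p a 1 (α i)) (fun j => negResidue p a 1 (β j)) m)
    (n : ℕ) : 0 ≤ padicValRat p (hgCoeff α β n) := by
  obtain ⟨B, hB, hB2⟩ :=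
    ((eventually_padicValRat_hgCoeff hα hβ n).and (eventually_ge_atTop 2)).exists
  rw [hB, sum_eq_sum_Ico_succ_bot hB2]
  have hrs' : (1 : ℤ) ≤ (r : ℤ) - s := by omega
  have hfirst : ((n / p : ℕ) : ℤ) ≤ levelVal α β p a n 1 := by
    rw [levelVal_eq hp.out hα hβ le_rfl, pow_one]
    have := h (n % p) (Nat.mod_lt n hp.out.pos).le
    have := le_mul_of_one_le_right (Int.natCast_nonneg (n / p)) hrs'
    linarith
  set bad := (Ico (1 + 1) B).filter fun k => levelVal α β p a n k < 0 with hbad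
  have hsum : -((s : ℤ) * bad.card) ≤ ∑ k ∈ Ico (1 + 1) B, levelVal α β p a n k := by
    rw [hbad, card_filter, Nat.cast_sum, mul_sum, ← sum_neg_distrib]
    refine sum_le_sum fun k hk => ?_
    by_cases hneg : levelVal α β p a n k < 0
    · rw [if_pos hneg, levelVal_eq hp.out hα hβ (by simp at hk; omega)]
      have := neg_le_countDiff (fun i => negResidue p a k (α i))
        (fun j => negResidue p a k (β j)) (n % p ^ k)
      have : 0 ≤ ((n / p ^ k : ℕ) : ℤ) * ((r : ℤ) - s) :=
        mul_nonneg (Int.natCast_nonneg _) (by omega)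
      push_cast at *
      linarith
    · simpa only [if_neg hneg, Nat.cast_zero, mul_zero, neg_zero] using not_lt.1 hneg
  have hcard : s * bad.card ≤ n / p := by
    rcases bad.eq_empty_or_nonempty with he | hne
    · simp [he]
    · have hmem := mem_filter.1 (bad.max'_mem hne)
      refine le_trans (Nat.mul_le_mul_left s ?_)
        (mul_pred_le_div_of_levelVal_neg hp.out hβ hps (mem_Ico.1 hmem.1).1 hmem.2)
      have hsub : bad ⊆ Icc 2 (bad.max' hne) := fun k hk =>
        mem_Icc.2 ⟨(mem_Ico.1 (mem_filter.1 hk).1).1, bad.le_max' k hk⟩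
      simpa using card_le_card hsub
  have : (s : ℤ) * bad.card ≤ ((n / p : ℕ) : ℤ) := by exact_mod_cast hcard
  linarith

/-- Theorem 1.2(ii): if `r > s`, `p > max(M_{α,β}, 3 s d_{α,β})` is prime, and
`a ∈ {1,…,d_{α,β}}` satisfies `a p ≡ 1 (mod d_{α,β})`, then `F_{α,β}(z) ∈ ℤ_p[[z]]`
iff `δ_{α,β}(x, a) ≥ 0` for all real `x`. -/
theorem stmt1 {r s : ℕ} (hr : 0 < r) (hs : 0 < s)
    (α : Fin r → ℚ) (β : Fin s → ℚ)
    (hα : ∀ i, ∀ m : ℤ, m ≤ 0 → α i ≠ (m : ℚ))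
    (hβ : ∀ j, ∀ m : ℤ, m ≤ 0 → β j ≠ (m : ℚ))
    (p : ℕ) (hp : p.Prime)
    (hpM : ∀ i, (p : ℚ) > (dab α β : ℚ) * (2 + 2 * |α i|))
    (hpM' : ∀ j, (p : ℚ) > (dab α β : ℚ) * (2 + 2 * |β j|))
    (hps : (p : ℚ) > 3 * s * (dab α β : ℚ))
    (a : ℕ) (ha1 : 1 ≤ a) (ha2 : a ≤ dab α β)
    (hamod : a * p ≡ 1 [MOD dab α β])
    (hrs : s < r) :
    (∀ n : ℕ, 0 ≤ padicValRat p (hgCoeff α β n)) ↔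
      (∀ x : ℝ, 0 ≤ christol α β x a) := by
  have : Fact p.Prime := ⟨hp⟩
  have hα' : ∀ i, IsSmallParam p (dab α β) a (α i) := fun i =>
    { ne_nonpos := hα i
      lt := hpM i
      den_dvd := (dvd_lcm (f := fun i => (α i).den) (mem_univ i)).trans (Nat.dvd_lcm_left _ _)
      d_pos := ha1.trans ha2
      a_pos := ha1
      modEq := hamod }
  have hβ' : ∀ j, IsSmallParam p (dab α β) a (β j) := fun j =>
    { ne_nonpos := hβ j
      lt := hpM' j
      den_dvd := (dvd_lcm (f := fun j => (β j).den) (mem_univ j)).trans (Nat.dvd_lcm_right _ _)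
      d_pos := ha1.trans ha2
      a_pos := ha1
      modEq := hamod }
  rw [christol_nonneg_iff hp hα' hβ']
  constructor
  · intro H m hm
    rw [← padicValRat_hgCoeff_of_le hα' hβ' hm]
    exact H m
  · exact padicValRat_hgCoeff_nonneg hα' hβ' (by exact_mod_cast hps) hrs
end
end

section
/- Let r and s be positive integers, let α = (α_1,…,α_r) and β = (β_1,…,β_s) with all α_i, β_j ∈ ℚ∖ℤ_{≤0}, let p be a prime with p > max(M_{α,β}, 3·s·d_{α,β}), and let a be the integer with 1 ≤ a ≤ d_{α,β} and a·p ≡ 1 (mod d_{α,β}). If r = s, then F_{α,β}(z) ∈ ℤ_p[[z]] if and only if both of the following hold: (1) Σ_{l=1}^{h} δ_{α,β}(a^l β_k, a^l) ≥ 0 for all h ∈ {1,…,ord(a)} and all k ∈ {1,…,s}; and (2) δ_{α,β}(a^l(e/d_{α,β} + m_{α,β}), a^l) ≥ 0 for all l ∈ {1,…,ord(a)} and all e ∈ {1,…,d_{α,β}}. Here ord(a) is the multiplicative order of a modulo d_{α,β}. -/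
open scoped BigOperators

noncomputable section

/-- `m_{α,β} = min_{i,j} {α_i - ⟨α_i⟩, β_j - ⟨β_j⟩}`. -/
def mab {r s : ℕ} (α : Fin r → ℚ) (β : Fin s → ℚ) : ℝ :=
  sInf ((fun γ : ℝ => γ - hfrac γ) ''
    (Set.range (fun i => (α i : ℝ)) ∪ Set.range (fun j => (β j : ℝ))))

/-- The representative of `a ^ l * g` modulo `d` in `{1, …, d}`. -/
def resid (d a l : ℕ) (g : ℤ) : ℤ := ((a : ℤ) ^ l * g - 1) % d + 1

/-- The least `j ≥ 0` with `p ^ l ∣ g + j * d`, see `pow_dvd_add_mul_iff`. -/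
def firstZero (d p a l : ℕ) (g : ℤ) : ℕ := ((p ^ l * resid d a l g - g) / d).toNat

/-- The conditions on the numerator of a parameter `g / d`: it is small with respect to `p`, and
the parameter is not a non-positive integer. -/
structure Admissible (d p : ℕ) (g : ℤ) : Prop where
  bound : 2 * (d : ℤ) + 2 * |g| < p
  ne_mul : ∀ m : ℤ, m ≤ 0 → g ≠ m * d

theorem resid_pos {d : ℕ} (hd : 0 < d) (a l : ℕ) (g : ℤ) : 1 ≤ resid d a l g := by
  have := Int.emod_nonneg ((a : ℤ) ^ l * g - 1) (b := (d : ℤ)) (by omega)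
  unfold resid
  omega

theorem resid_le {d : ℕ} (hd : 0 < d) (a l : ℕ) (g : ℤ) : resid d a l g ≤ d := by
  have := Int.emod_lt_of_pos ((a : ℤ) ^ l * g - 1) (b := (d : ℤ)) (by omega)
  unfold resid
  omega

theorem resid_modEq (d a l : ℕ) (g : ℤ) : resid d a l g ≡ (a : ℤ) ^ l * g [ZMOD d] := by
  have := (Int.mod_modEq ((a : ℤ) ^ l * g - 1) d).add_right 1
  simpa [resid] using this

theorem eq_of_modEq_of_mem {d : ℕ} {x y : ℤ} (h : x ≡ y [ZMOD d]) (hx : 1 ≤ x) (hx' : x ≤ d)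
    (hy : 1 ≤ y) (hy' : y ≤ d) : x = y := by
  have h1 : x - 1 ≡ y - 1 [ZMOD d] := h.sub_right 1
  have := h1.eq
  rw [Int.emod_eq_of_lt (by omega) (by omega), Int.emod_eq_of_lt (by omega) (by omega)] at this
  omega

theorem resid_eq_iff {d : ℕ} (hd : 0 < d) {a l : ℕ} {g x : ℤ} (hx : 1 ≤ x) (hx' : x ≤ d) :
    resid d a l g = x ↔ (a : ℤ) ^ l * g ≡ x [ZMOD d] := by
  constructor
  · rintro rfl
    exact (resid_modEq d a l g).symm
  · intro h
    exact eq_of_modEq_of_mem ((resid_modEq d a l g).trans h) (resid_pos hd a l g)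
      (resid_le hd a l g) hx hx'

theorem pow_mul_pow_modEq {d p a : ℕ} (hap : (a : ℤ) * p ≡ 1 [ZMOD d]) (l : ℕ) :
    (p : ℤ) ^ l * (a : ℤ) ^ l ≡ 1 [ZMOD d] := by
  have := hap.pow l
  rwa [mul_pow, one_pow, mul_comm] at this

theorem resid_eq_resid_iff {d p a : ℕ} (hd : 0 < d) (hap : (a : ℤ) * p ≡ 1 [ZMOD d]) (l : ℕ)
    (g g' : ℤ) : resid d a l g = resid d a l g' ↔ g ≡ g' [ZMOD d] := by
  rw [resid_eq_iff hd (resid_pos hd a l g') (resid_le hd a l g')]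
  constructor
  · intro h
    have h1 := (h.trans (resid_modEq d a l g')).mul_left ((p : ℤ) ^ l)
    have h2 := (pow_mul_pow_modEq hap l).mul_right g
    have h3 := (pow_mul_pow_modEq hap l).mul_right g'
    rw [mul_assoc, one_mul] at h2 h3
    exact (h2.symm.trans h1).trans h3
  · intro h
    exact (h.mul_left _).trans (resid_modEq d a l g').symm

theorem resid_periodic {d a o : ℕ} (ho : (a : ℤ) ^ o ≡ 1 [ZMOD d]) (l : ℕ) (g : ℤ) :
    resid d a (l + o) g = resid d a l g := by
  unfold resid
  have h : (a : ℤ) ^ (l + o) * g - 1 ≡ (a : ℤ) ^ l * g - 1 [ZMOD d] := by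
    have := ((ho.mul_left ((a : ℤ) ^ l)).mul_right g).sub_right 1
    rwa [mul_one, ← pow_add] at this
  rw [h.eq]

theorem isCoprime_pow_of_modEq {d p a : ℕ} (hap : (a : ℤ) * p ≡ 1 [ZMOD d]) (l : ℕ) :
    IsCoprime ((p : ℤ) ^ l) d := by
  apply IsCoprime.pow_left
  obtain ⟨c, hc⟩ := hap.dvd
  exact ⟨a, c, by linarith⟩

section firstZero

variable {d p a : ℕ} (hd : 0 < d) (hap : (a : ℤ) * p ≡ 1 [ZMOD d])
include hd hap

theorem mul_firstZero {l : ℕ} (hl : 1 ≤ l) {g : ℤ} (hg : Admissible d p g) :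
    (d : ℤ) * firstZero d p a l g = p ^ l * resid d a l g - g := by
  have hp1 : (1 : ℤ) ≤ p := by have := hg.bound; have := abs_nonneg g; omega
  have hdvd : (d : ℤ) ∣ p ^ l * resid d a l g - g := by
    have h1 := (resid_modEq d a l g).mul_left ((p : ℤ) ^ l)
    have h2 := (pow_mul_pow_modEq hap l).mul_right g
    rw [mul_assoc, one_mul] at h2
    exact (h1.trans h2).symm.dvd
  have hnn : 0 ≤ (p : ℤ) ^ l * resid d a l g - g := by
    have h1 : (p : ℤ) ≤ p ^ l := le_self_pow₀ hp1 (by omega)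
    have h2 := resid_pos hd a l g
    have h3 := hg.bound
    have h4 := le_abs_self g
    have h5 := abs_nonneg g
    nlinarith
  rw [firstZero, Int.toNat_of_nonneg (Int.ediv_nonneg hnn (by omega)), Int.mul_ediv_cancel' hdvd]

theorem firstZero_lt {l : ℕ} (hl : 1 ≤ l) {g : ℤ} (hg : Admissible d p g) :
    firstZero d p a l g < p ^ l := by
  have h := mul_firstZero hd hap hl hg
  have hp1 : (1 : ℤ) ≤ p := by have := hg.bound; have := abs_nonneg g; omega
  have h1 : (p : ℤ) ≤ p ^ l := le_self_pow₀ hp1 (by omega)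
  have h2 := resid_le hd a l g
  have h3 := hg.bound
  have h4 := neg_abs_le g
  have hd' : (0 : ℤ) < d := by omega
  have : (firstZero d p a l g : ℤ) < p ^ l := by
    by_contra! hcon
    rcases h2.lt_or_eq with h2 | h2
    · nlinarith
    · rw [h2] at h
      have h5 : g = (p ^ l - firstZero d p a l g : ℤ) * d := by linarith
      exact hg.ne_mul _ (by linarith) h5
  exact_mod_cast this

theorem pow_pred_le_firstZero {l : ℕ} {g : ℤ} (hg : Admissible d p g) :
    p ^ l ≤ firstZero d p a (l + 1) g := by
  have h := mul_firstZero hd hap (Nat.le_add_left 1 l) hg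
  have hp1 : (1 : ℤ) ≤ p := by have := hg.bound; have := abs_nonneg g; omega
  have h1 : (1 : ℤ) ≤ p ^ l := one_le_pow₀ hp1
  have h2 := resid_pos hd a (l + 1) g
  have h3 := hg.bound
  have h4 := le_abs_self g
  have h5 := abs_nonneg g
  have hd' : (0 : ℤ) < d := by omega
  have : (p : ℤ) ^ l ≤ firstZero d p a (l + 1) g := by
    refine le_of_mul_le_mul_left ?_ hd'
    rw [h]
    have h6 : (p : ℤ) ^ l * p ≤ (p : ℤ) ^ l * p * resid d a (l + 1) g :=
      le_mul_of_one_le_right (by positivity) h2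
    rw [pow_succ]
    nlinarith
  exact_mod_cast this

theorem pow_le_firstZero {l m : ℕ} (hl : l < m) {g : ℤ} (hg : Admissible d p g) :
    p ^ l ≤ firstZero d p a m g := by
  obtain ⟨m, rfl⟩ : ∃ k, m = k + 1 := ⟨m - 1, by omega⟩
  have hp1 : 1 ≤ p := by have := hg.bound; have := abs_nonneg g; omega
  exact (Nat.pow_le_pow_right hp1 (by omega)).trans (pow_pred_le_firstZero hd hap hg)

theorem pow_dvd_add_mul_iff {l : ℕ} (hl : 1 ≤ l) {g : ℤ} (hg : Admissible d p g) (j : ℕ) :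
    (p : ℤ) ^ l ∣ g + j * d ↔ j ≡ firstZero d p a l g [MOD p ^ l] := by
  have h := mul_firstZero hd hap hl hg
  have hc := isCoprime_pow_of_modEq hap l
  have h1 : g + j * d = p ^ l * resid d a l g - (firstZero d p a l g - j) * d := by linarith
  rw [h1, dvd_sub_right (dvd_mul_right _ _), ← Int.natCast_modEq_iff, Int.modEq_iff_dvd,
    Nat.cast_pow]
  exact ⟨hc.dvd_of_dvd_mul_right, fun h => h.mul_right _⟩

theorem firstZero_modEq {l h : ℕ} (hl : 1 ≤ l) (hlh : l ≤ h) {g : ℤ} (hg : Admissible d p g) :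
    firstZero d p a h g ≡ firstZero d p a l g [MOD p ^ l] := by
  rw [← pow_dvd_add_mul_iff hd hap hl hg]
  exact (pow_dvd_pow _ hlh).trans
    ((pow_dvd_add_mul_iff hd hap (hl.trans hlh) hg _).2 (Nat.ModEq.refl _))

theorem firstZero_le_iff {l : ℕ} (hl : 1 ≤ l) {g g' : ℤ} (hg : Admissible d p g)
    (hg' : Admissible d p g') :
    firstZero d p a l g ≤ firstZero d p a l g' ↔
      resid d a l g < resid d a l g' ∨ (resid d a l g = resid d a l g' ∧ g' ≤ g) := by
  have h := mul_firstZero hd hap hl hg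
  have h' := mul_firstZero hd hap hl hg'
  have hp1 : (1 : ℤ) ≤ p := by have := hg.bound; have := abs_nonneg g; omega
  have h1 : (p : ℤ) ≤ p ^ l := le_self_pow₀ hp1 (by omega)
  have hb := hg.bound
  have hb' := hg'.bound
  have e1 := le_abs_self g
  have e2 := neg_abs_le g
  have e3 := le_abs_self g'
  have e4 := neg_abs_le g'
  have hd' : (0 : ℤ) < d := by omega
  have key : firstZero d p a l g ≤ firstZero d p a l g' ↔
      (p : ℤ) ^ l * resid d a l g - g ≤ p ^ l * resid d a l g' - g' := by
    rw [← h, ← h', mul_le_mul_iff_right₀ hd', Nat.cast_le]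
  rw [key]
  rcases lt_trichotomy (resid d a l g) (resid d a l g') with hlt | heq | hgt
  · simp only [hlt, true_or, iff_true]
    nlinarith
  · simp only [heq, lt_irrefl, false_or, true_and]
    constructor <;> intro <;> linarith
  · refine iff_of_false ?_ ?_
    · intro hle
      nlinarith
    · rintro (h | ⟨h, -⟩) <;> omega

theorem firstZero_sub_eq {l h : ℕ} (hl : 1 ≤ l) (hh : 1 ≤ h) {g g' : ℤ}
    (hg : Admissible d p g) (hg' : Admissible d p g') (hgg : g ≡ g' [ZMOD d]) :
    (firstZero d p a l g : ℤ) - firstZero d p a l g' =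
      firstZero d p a h g - firstZero d p a h g' := by
  have hd' : (d : ℤ) ≠ 0 := by omega
  apply mul_left_cancel₀ hd'
  rw [mul_sub, mul_sub, mul_firstZero hd hap hl hg, mul_firstZero hd hap hl hg',
    mul_firstZero hd hap hh hg, mul_firstZero hd hap hh hg',
    (resid_eq_resid_iff hd hap l g g').2 hgg, (resid_eq_resid_iff hd hap h g g').2 hgg]
  ring

end firstZero

theorem padicValRat_int_eq_sum {p : ℕ} (hp : p.Prime) {z : ℤ} (hz : z ≠ 0) {L : ℕ}
    (hL : Nat.log p z.natAbs < L) :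
    padicValRat p z = ∑ l ∈ Finset.Ico 1 L, if (p : ℤ) ^ l ∣ z then (1 : ℤ) else 0 := by
  have : Fact p.Prime := ⟨hp⟩
  have hz' : 0 < z.natAbs := Int.natAbs_pos.2 hz
  have h1 := Nat.emultiplicity_eq_card_pow_dvd hp.ne_one hz' hL
  rw [← padicValNat_eq_emultiplicity hz'.ne'] at h1
  rw [padicValRat.of_int, padicValInt, Nat.cast_inj.1 h1, Finset.sum_boole]
  congr 2
  ext l
  simp [← Int.natCast_dvd]

theorem padicValRat_ascPochhammer_eval {d p a : ℕ} (hp : p.Prime) (hd : 0 < d)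
    (hap : (a : ℤ) * p ≡ 1 [ZMOD d]) {g : ℤ} (hg : Admissible d p g) (n : ℕ) :
    (ascPochhammer ℚ n).eval ((g : ℚ) / d) ≠ 0 ∧ ∀ᶠ L in Filter.atTop,
      padicValRat p ((ascPochhammer ℚ n).eval ((g : ℚ) / d)) = ∑ l ∈ Finset.Ico 1 L,
        ((n.count (· ≡ firstZero d p a l g [MOD p ^ l]) : ℕ) : ℤ) := by
  have : Fact p.Prime := ⟨hp⟩
  induction n with
  | zero => simp
  | succ n ih =>
    obtain ⟨ih0, ih⟩ := ih
    have hdq : (d : ℚ) ≠ 0 := by positivity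
    have hz : g + n * d ≠ 0 := fun h => hg.ne_mul (-n) (by omega) (by linarith)
    have heq : (g : ℚ) / d + n = ((g + n * d : ℤ) : ℚ) / (d : ℤ) := by
      push_cast
      field_simp
    have hz' : ((g + n * d : ℤ) : ℚ) ≠ 0 := by exact_mod_cast hz
    have hdq' : ((d : ℤ) : ℚ) ≠ 0 := by exact_mod_cast hdq
    have hne : (g : ℚ) / d + n ≠ 0 := by
      rw [heq]
      exact div_ne_zero hz' hdq'
    have hdv : padicValRat p ((d : ℤ) : ℚ) = 0 := by
      have hpd : ¬ p ∣ d := by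
        have h1 := isCoprime_pow_of_modEq hap 1
        rw [pow_one, Nat.isCoprime_iff_coprime] at h1
        exact (Nat.Prime.coprime_iff_not_dvd hp).1 h1
      rw [padicValRat.of_int, padicValInt.of_nat, padicValNat.eq_zero_of_not_dvd hpd]
      rfl
    rw [ascPochhammer_succ_eval]
    refine ⟨mul_ne_zero ih0 hne, ?_⟩
    filter_upwards [ih, Filter.eventually_gt_atTop (Nat.log p (g + n * d).natAbs)] with L h1 h2
    rw [padicValRat.mul ih0 hne, h1, heq, padicValRat.div hz' hdq', hdv, sub_zero,
      padicValRat_int_eq_sum hp hz h2, ← Finset.sum_add_distrib]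
    refine Finset.sum_congr rfl fun l hl => ?_
    rw [Nat.count_succ]
    simp only [pow_dvd_add_mul_iff hd hap (Finset.mem_Ico.1 hl).1 hg]
    push_cast
    rfl

/-- The number of `i` such that `P (A i)` minus the number of `j` such that `P (B j)`. -/
def excess {r s : ℕ} (A : Fin r → ℤ) (B : Fin s → ℤ) (P : ℤ → Prop) : ℤ :=
  (Nat.card {i : Fin r // P (A i)} : ℤ) - (Nat.card {j : Fin s // P (B j)} : ℤ)

open scoped Classical in
theorem excess_eq_sum {r s : ℕ} (A : Fin r → ℤ) (B : Fin s → ℤ) (P : ℤ → Prop) :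
    excess A B P = ∑ i, (if P (A i) then (1 : ℤ) else 0) - ∑ j, if P (B j) then (1 : ℤ) else 0 := by
  simp [excess, Nat.card_eq_fintype_card, Fintype.card_subtype]

theorem excess_mono {r s : ℕ} {A : Fin r → ℤ} {B : Fin s → ℤ} {P Q : ℤ → Prop}
    (hA : ∀ i, P (A i) → Q (A i)) (hB : ∀ j, Q (B j) → P (B j)) :
    excess A B P ≤ excess A B Q := by
  classical
  rw [excess_eq_sum, excess_eq_sum]
  refine sub_le_sub (Finset.sum_le_sum fun i _ => ?_) (Finset.sum_le_sum fun j _ => ?_)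
  · have := hA i
    split_ifs <;> simp_all
  · have := hB j
    split_ifs <;> simp_all

theorem excess_congr {r s : ℕ} {A : Fin r → ℤ} {B : Fin s → ℤ} {P Q : ℤ → Prop}
    (hA : ∀ i, P (A i) ↔ Q (A i)) (hB : ∀ j, P (B j) ↔ Q (B j)) :
    excess A B P = excess A B Q :=
  le_antisymm (excess_mono (fun i => (hA i).1) fun j => (hB j).2)
    (excess_mono (fun i => (hA i).2) fun j => (hB j).1)

theorem excess_of_forall_not {r s : ℕ} {A : Fin r → ℤ} {B : Fin s → ℤ} {P : ℤ → Prop}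
    (hA : ∀ i, ¬ P (A i)) (hB : ∀ j, ¬ P (B j)) : excess A B P = 0 := by
  classical
  simp [excess_eq_sum, hA, hB]

theorem excess_of_forall {r : ℕ} {A B : Fin r → ℤ} {P : ℤ → Prop}
    (hA : ∀ i, P (A i)) (hB : ∀ j, P (B j)) : excess A B P = 0 := by
  classical
  simp [excess_eq_sum, hA, hB]

theorem padicValRat_prod {ι : Type*} {p : ℕ} [Fact p.Prime] (S : Finset ι) {f : ι → ℚ}
    (hf : ∀ i ∈ S, f i ≠ 0) : padicValRat p (∏ i ∈ S, f i) = ∑ i ∈ S, padicValRat p (f i) := by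
  classical
  induction S using Finset.induction_on with
  | empty => simp
  | insert i S hi ih =>
    rw [Finset.prod_insert hi, Finset.sum_insert hi,
      padicValRat.mul (hf i (by simp)) (Finset.prod_ne_zero_iff.2 fun j hj => hf j (by simp [hj])),
      ih fun j hj => hf j (by simp [hj])]

section core

variable {d p a r : ℕ} (hp : p.Prime) (hd : 0 < d) (hap : (a : ℤ) * p ≡ 1 [ZMOD d])
  {A B : Fin r → ℤ} (hA : ∀ i, Admissible d p (A i)) (hB : ∀ j, Admissible d p (B j))
include hp hd hap hA hB

theorem padicValRat_hgCoeff (n : ℕ) : ∀ᶠ L in Filter.atTop,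
    padicValRat p (hgCoeff (fun i => (A i : ℚ) / d) (fun j => (B j : ℚ) / d) n) =
      ∑ l ∈ Finset.Ico 1 L, excess A B (fun g => firstZero d p a l g < n % p ^ l) := by
  classical
  have : Fact p.Prime := ⟨hp⟩
  have hA' := fun i => padicValRat_ascPochhammer_eval hp hd hap (hA i) n
  have hB' := fun j => padicValRat_ascPochhammer_eval hp hd hap (hB j) n
  filter_upwards [Filter.eventually_all.2 fun i => (hA' i).2,
    Filter.eventually_all.2 fun j => (hB' j).2] with L h1 h2
  have count_eq : ∀ {g : ℤ}, Admissible d p g → ∀ l ∈ Finset.Ico 1 L,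
      ((n.count (· ≡ firstZero d p a l g [MOD p ^ l]) : ℕ) : ℤ) =
        (n / p ^ l : ℕ) + if firstZero d p a l g < n % p ^ l then 1 else 0 := by
    intro g hg l hl
    rw [Nat.count_modEq_card _ (pow_pos hp.pos l),
      Nat.mod_eq_of_lt (firstZero_lt hd hap (Finset.mem_Ico.1 hl).1 hg)]
    push_cast
    rfl
  rw [hgCoeff, padicValRat.div (Finset.prod_ne_zero_iff.2 fun i _ => (hA' i).1)
    (Finset.prod_ne_zero_iff.2 fun j _ => (hB' j).1), padicValRat_prod _ fun i _ => (hA' i).1,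
    padicValRat_prod _ fun j _ => (hB' j).1, Finset.sum_congr rfl fun i _ => h1 i,
    Finset.sum_congr rfl fun j _ => h2 j, Finset.sum_comm, Finset.sum_comm (s := Finset.univ),
    ← Finset.sum_sub_distrib]
  refine Finset.sum_congr rfl fun l hl => ?_
  rw [Finset.sum_congr rfl fun i _ => count_eq (hA i) l hl,
    Finset.sum_congr rfl fun j _ => count_eq (hB j) l hl, Finset.sum_add_distrib,
    Finset.sum_add_distrib, excess_eq_sum]
  rw [add_sub_add_left_eq_sub]
  congr!

theorem padicValRat_hgCoeff_of_le_pow (n h : ℕ) (hn : n ≤ p ^ h) :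
    padicValRat p (hgCoeff (fun i => (A i : ℚ) / d) (fun j => (B j : ℚ) / d) n) =
      ∑ l ∈ Finset.Icc 1 h, excess A B (fun g => firstZero d p a l g < n % p ^ l) := by
  obtain ⟨L, hL, hhL⟩ := ((padicValRat_hgCoeff hp hd hap hA hB n).and
    (Filter.eventually_gt_atTop h)).exists
  rw [hL]
  symm
  refine Finset.sum_subset (fun l hl => ?_) fun l hl hl' => ?_
  · rw [Finset.mem_Icc] at hl
    rw [Finset.mem_Ico]
    omega
  · rw [Finset.mem_Ico] at hl
    rw [Finset.mem_Icc] at hl'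
    have key : ∀ {g}, Admissible d p g → ¬ firstZero d p a l g < n % p ^ l := fun hg =>
      not_lt.2 (((Nat.mod_le _ _).trans hn).trans
        (pow_le_firstZero hd hap (by omega) hg))
    exact excess_of_forall_not (fun i => key (hA i)) fun j => key (hB j)

omit hp in
theorem excess_firstZero_lt_mod {h l : ℕ} (hl : 1 ≤ l) (hlh : l ≤ h) (k : Fin r) :
    excess A B (fun g => firstZero d p a l g < (firstZero d p a h (B k) + 1) % p ^ l) =
      excess A B (fun g => firstZero d p a l g ≤ firstZero d p a l (B k)) := by
  set b := B k
  have hb : Admissible d p b := hB _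
  have hmod : (firstZero d p a h b + 1) % p ^ l = (firstZero d p a l b + 1) % p ^ l :=
    (firstZero_modEq hd hap hl hlh hb).add_right 1
  rw [hmod]
  rcases (Nat.succ_le_of_lt (firstZero_lt hd hap hl hb)).lt_or_eq with hlt | heq
  · rw [Nat.mod_eq_of_lt hlt]
    simp only [Nat.lt_succ_iff]
  · have h0 : (firstZero d p a l b + 1) % p ^ l = 0 := by
      rw [← Nat.succ_eq_add_one, heq, Nat.mod_self]
    rw [h0, excess_of_forall_not (by simp) (by simp), excess_of_forall]
    · intro i
      exact Nat.lt_succ_iff.1 (heq ▸ firstZero_lt hd hap hl (hA i))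
    · intro i
      exact Nat.lt_succ_iff.1 (heq ▸ firstZero_lt hd hap hl (hB i))

theorem exists_excess_firstZero_eq_excess_resid {l : ℕ} (hl : 1 ≤ l) {t : ℤ} (ht : 1 ≤ t)
    (htd : t < d) : ∃ n ≤ p ^ l, p ^ (l - 1) ∣ n ∧
      excess A B (fun g => firstZero d p a l g < n % p ^ l) =
        excess A B (fun g => resid d a l g ≤ t) := by
  obtain ⟨l, rfl⟩ : ∃ k, l = k + 1 := ⟨l - 1, by omega⟩
  rw [Nat.add_sub_cancel]
  have hd' : (0 : ℤ) < d := by omega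
  have hp0 : (0 : ℤ) < p := by exact_mod_cast hp.pos
  have hP : (0 : ℤ) < (p : ℤ) ^ l := by positivity
  obtain ⟨q, hq1, hq2⟩ : ∃ q : ℕ, 2 * d * (q : ℤ) ≤ 2 * p * t + p ∧
      2 * p * t + p < 2 * d * (q : ℤ) + 2 * d := by
    have h1 := Int.mul_ediv_add_emod (2 * p * t + p) (2 * d)
    have h2 := Int.emod_nonneg (2 * p * t + p) (b := 2 * d) (by omega)
    have h3 := Int.emod_lt_of_pos (2 * p * t + p) (b := 2 * d) (by omega)
    have h4 : 0 ≤ (2 * p * t + p) / (2 * d : ℤ) := Int.ediv_nonneg (by positivity) (by omega)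
    refine ⟨((2 * p * t + p) / (2 * d : ℤ)).toNat, ?_, ?_⟩
    all_goals rw [Int.toNat_of_nonneg h4]; linarith
  have hqp : q < p := by
    have : (q : ℤ) < p := by nlinarith
    exact_mod_cast this
  have hnlt : p ^ l * q < p ^ (l + 1) := by
    rw [pow_succ]
    exact Nat.mul_lt_mul_of_pos_left hqp (pow_pos hp.pos l)
  refine ⟨p ^ l * q, hnlt.le, dvd_mul_right _ _, ?_⟩
  rw [Nat.mod_eq_of_lt hnlt]
  have key : ∀ {g}, Admissible d p g →
      (firstZero d p a (l + 1) g < p ^ l * q ↔ resid d a (l + 1) g ≤ t) := by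
    intro g hg
    have h := mul_firstZero hd hap (Nat.le_add_left 1 l) hg
    have h1 := hg.bound
    have h2 := le_abs_self g
    have h3 := neg_abs_le g
    have h4 : |g| ≤ p ^ l * |g| :=
      le_mul_of_one_le_left (abs_nonneg g) (by linarith)
    have e : firstZero d p a (l + 1) g < p ^ l * q ↔
        (p : ℤ) ^ l * (p * resid d a (l + 1) g) - g < p ^ l * (d * q) := by
      rw [← mul_assoc, ← pow_succ, ← h, mul_left_comm, mul_lt_mul_iff_right₀ hd']
      exact_mod_cast Iff.rfl
    rw [e]
    constructor
    · intro hlt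
      by_contra! hcon
      have h5 : (p : ℤ) * (t + 1) ≤ p * resid d a (l + 1) g := by gcongr; omega
      have h6 : (0 : ℤ) ≤ p * resid d a (l + 1) g - |g| - d * q := by linarith
      nlinarith
    · intro hle
      have h5 : (p : ℤ) * resid d a (l + 1) g ≤ p * t := by gcongr
      have h6 : (0 : ℤ) < d * q - p * resid d a (l + 1) g - |g| := by linarith
      nlinarith
  exact excess_congr (fun i => key (hA i)) fun j => key (hB j)

omit hp in
theorem exists_excess_le_of_neg {h n : ℕ} (hh : 1 ≤ h)
    (hneg : excess A B (fun g => firstZero d p a h g < n % p ^ h) < 0)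
    (hresid : ∀ t : ℤ, 1 ≤ t → t ≤ d → 0 ≤ excess A B (fun g => resid d a h g ≤ t)) :
    ∃ k, ∀ l, 1 ≤ l → l ≤ h →
      excess A B (fun g => firstZero d p a l g ≤ firstZero d p a l (B k)) ≤
        excess A B (fun g => firstZero d p a l g < n % p ^ l) := by
  classical
  let S : Finset (Fin r) := {j | firstZero d p a h (B j) < n % p ^ h}
  have hS : S.Nonempty := by
    by_contra hS
    have h0 : ∀ j, ¬ firstZero d p a h (B j) < n % p ^ h := by
      simpa [S, Finset.not_nonempty_iff_eq_empty, Finset.filter_eq_empty_iff] using hS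
    have h1 : excess A B (fun _ => False) ≤
        excess A B (fun g => firstZero d p a h g < n % p ^ h) :=
      excess_mono (fun _ => False.elim) h0
    rw [excess_of_forall_not (by simp) (by simp)] at h1
    omega
  obtain ⟨k, hkS, hmax⟩ := S.exists_max_image (fun j => firstZero d p a h (B j)) hS
  have hk : firstZero d p a h (B k) < n % p ^ h := by simpa [S] using hkS
  have hmax' : ∀ j, firstZero d p a h (B j) < n % p ^ h →
      firstZero d p a h (B j) ≤ firstZero d p a h (B k) :=
    fun j hj => hmax j (by simpa [S] using hj)
  obtain ⟨i, hi, hi'⟩ : ∃ i, resid d a h (A i) ≤ resid d a h (B k) ∧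
      n % p ^ h ≤ firstZero d p a h (A i) := by
    by_contra! hcon
    have h1 := hresid _ (resid_pos hd a h (B k)) (resid_le hd a h (B k))
    have h2 : excess A B (fun g => resid d a h g ≤ resid d a h (B k)) ≤
        excess A B (fun g => firstZero d p a h g < n % p ^ h) := by
      refine excess_mono hcon fun j hj => ?_
      rcases (firstZero_le_iff hd hap hh (hB j) (hB k)).1 (hmax' j hj) with h3 | h3
      · exact h3.le
      · exact h3.1.le
    omega
  have hik : B k ≡ A i [ZMOD d] := by
    rw [← resid_eq_resid_iff hd hap h]
    rcases (firstZero_le_iff hd hap hh (hB k) (hA i)).1 (hk.le.trans hi') with h3 | h3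
    · omega
    · exact h3.1
  refine ⟨k, fun l hl hlh => ?_⟩
  have hshift := firstZero_sub_eq hd hap hl hh (hA i) (hB k) hik.symm
  have hmod : n % p ^ l + firstZero d p a h (B k) = firstZero d p a l (B k) + n % p ^ h := by
    have hlt := firstZero_lt hd hap hl (hA i)
    have h1 : n ≡ firstZero d p a l (B k) + (n % p ^ h - firstZero d p a h (B k))
        [MOD p ^ l] := by
      have h2 : n % p ^ h ≡ n [MOD p ^ l] := (Nat.mod_modEq n _).of_dvd (pow_dvd_pow p hlh)
      have h3 := (firstZero_modEq hd hap hl hlh (hB k)).add_right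
        (n % p ^ h - firstZero d p a h (B k))
      rw [Nat.add_sub_cancel' hk.le] at h3
      exact h2.symm.trans h3
    have h4 := Nat.mod_eq_of_modEq h1 (by omega)
    omega
  refine excess_mono (fun i' hi' => by omega) fun j hj => ?_
  by_contra! hcon
  have hjk : B j ≡ B k [ZMOD d] := by
    rw [← resid_eq_resid_iff hd hap l]
    have h1 := (firstZero_le_iff hd hap hl (hB k) (hB j)).1 hcon.le
    have h2 := (firstZero_le_iff hd hap hl (hB j) (hA i)).1 (by omega)
    have h3 := (resid_eq_resid_iff hd hap l _ _).2 hik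
    omega
  have hshift' := firstZero_sub_eq hd hap hl hh (hB j) (hB k) hjk
  have := hmax' j (by omega)
  omega

theorem hgCoeff_integral_iff :
    (∀ n, 0 ≤ padicValRat p (hgCoeff (fun i => (A i : ℚ) / d) (fun j => (B j : ℚ) / d) n)) ↔
      (∀ k, ∀ h, 0 ≤ ∑ l ∈ Finset.Icc 1 h,
        excess A B (fun g => firstZero d p a l g ≤ firstZero d p a l (B k))) ∧
      ∀ l, 1 ≤ l → ∀ t : ℤ, 1 ≤ t → t ≤ d → 0 ≤ excess A B (fun g => resid d a l g ≤ t) := by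
  constructor
  · intro hintegral
    refine ⟨fun k h => ?_, fun l hl t ht htd => ?_⟩
    · rcases Nat.eq_zero_or_pos h with rfl | hh
      · simp
      have h1 := hintegral (firstZero d p a h (B k) + 1)
      rw [padicValRat_hgCoeff_of_le_pow hp hd hap hA hB _ h
        (firstZero_lt hd hap hh (hB k))] at h1
      refine h1.trans_eq (Finset.sum_congr rfl fun l hl => ?_)
      rw [Finset.mem_Icc] at hl
      exact excess_firstZero_lt_mod hd hap hA hB hl.1 hl.2 k
    · rcases htd.lt_or_eq with htd | rfl
      · obtain ⟨n, hn, hdvd, hex⟩ :=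
          exists_excess_firstZero_eq_excess_resid hp hd hap hA hB hl ht htd
        have h1 := hintegral n
        rw [padicValRat_hgCoeff_of_le_pow hp hd hap hA hB n l hn,
          Finset.sum_eq_single_of_mem l (by simp [hl])] at h1
        · exact hex ▸ h1
        · intro m hm hml
          rw [Finset.mem_Icc] at hm
          have h0 : n % p ^ m = 0 :=
            Nat.mod_eq_zero_of_dvd ((pow_dvd_pow p (by omega)).trans hdvd)
          rw [h0]
          exact excess_of_forall_not (by simp) (by simp)
      · have h1 : excess A B (fun g => resid d a l g ≤ d) = 0 :=
          excess_of_forall (fun i => resid_le hd a l _) fun j => resid_le hd a l _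
        exact h1.ge
  · rintro ⟨h1, h2⟩ n
    obtain ⟨L, hL⟩ := (padicValRat_hgCoeff hp hd hap hA hB n).exists
    rw [hL]
    let S : Finset ℕ :=
      {h ∈ Finset.Ico 1 L | excess A B (fun g => firstZero d p a h g < n % p ^ h) < 0}
    rcases S.eq_empty_or_nonempty with hS | hS
    · refine Finset.sum_nonneg fun l hl => ?_
      simpa using (Finset.filter_eq_empty_iff.1 hS) hl
    obtain ⟨h, hhS, hmax⟩ := S.exists_max_image id hS
    obtain ⟨hhL, hneg⟩ := Finset.mem_filter.1 hhS
    rw [Finset.mem_Ico] at hhL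
    obtain ⟨k, hk⟩ := exists_excess_le_of_neg hd hap hA hB hhL.1 hneg (h2 h hhL.1)
    calc (0 : ℤ) ≤ ∑ l ∈ Finset.Icc 1 h,
          excess A B (fun g => firstZero d p a l g ≤ firstZero d p a l (B k)) := h1 k h
      _ ≤ ∑ l ∈ Finset.Icc 1 h, excess A B (fun g => firstZero d p a l g < n % p ^ l) :=
        Finset.sum_le_sum fun l hl => hk l (Finset.mem_Icc.1 hl).1 (Finset.mem_Icc.1 hl).2
      _ ≤ _ := by
        refine Finset.sum_le_sum_of_subset_of_nonneg (fun l hl => ?_) fun l hl hl' => ?_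
        · rw [Finset.mem_Icc] at hl
          rw [Finset.mem_Ico]
          omega
        · by_contra! hcon
          have h3 : l ≤ h := hmax l (Finset.mem_filter.2 ⟨hl, hcon⟩)
          exact hl' (Finset.mem_Icc.2 ⟨(Finset.mem_Ico.1 hl).1, h3⟩)

end core

theorem sum_Icc_nonneg_of_periodic {f : ℕ → ℤ} {o : ℕ} (ho : 0 < o) (hf : ∀ l, f (l + o) = f l)
    (h0 : ∀ h ∈ Finset.Icc 1 o, 0 ≤ ∑ l ∈ Finset.Icc 1 h, f l) (h : ℕ) :
    0 ≤ ∑ l ∈ Finset.Icc 1 h, f l := by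
  have hadd : ∀ m, ∑ l ∈ Finset.Icc 1 (m + o), f l =
      ∑ l ∈ Finset.Icc 1 o, f l + ∑ l ∈ Finset.Icc 1 m, f l := by
    intro m
    induction m with
    | zero => simp
    | succ m ih =>
      rw [Finset.sum_Icc_succ_top (by omega), add_right_comm, Finset.sum_Icc_succ_top (by omega),
        ih, add_right_comm m 1 o |>.symm, hf, add_assoc]
  induction h using Nat.strong_induction_on with
  | _ h ih =>
    rcases Nat.eq_zero_or_pos h with rfl | hpos
    · simp
    by_cases hh : h ≤ o
    · exact h0 h (Finset.mem_Icc.2 ⟨hpos, hh⟩)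
    · have h1 := hadd (h - o)
      rw [Nat.sub_add_cancel (by omega)] at h1
      rw [h1]
      exact add_nonneg (h0 o (Finset.mem_Icc.2 ⟨ho, le_rfl⟩)) (ih _ (by omega))

theorem hfrac_eq {x y : ℝ} {k : ℤ} (hx : x = y + k) (h0 : 0 < y) (h1 : y ≤ 1) : hfrac x = y := by
  have : ⌈x⌉ = k + 1 := by
    rw [Int.ceil_eq_iff]
    push_cast
    constructor <;> linarith
  rw [hfrac, this]
  push_cast
  linarith

theorem hfrac_pow_mul_div {d : ℕ} (hd : 0 < d) (a l : ℕ) (g : ℤ) :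
    hfrac (((a ^ l : ℕ) : ℝ) * ((g : ℝ) / d)) = (resid d a l g : ℝ) / d := by
  have hdR : (0 : ℝ) < d := by exact_mod_cast hd
  obtain ⟨c, hc⟩ := (resid_modEq d a l g).dvd
  have hc' : ((a : ℝ) ^ l * g : ℝ) - resid d a l g = d * c := by exact_mod_cast hc
  have h1 : (1 : ℝ) ≤ resid d a l g := by exact_mod_cast resid_pos hd a l g
  have h2 : (resid d a l g : ℝ) ≤ d := by exact_mod_cast resid_le hd a l g
  refine hfrac_eq (k := c) ?_ (by positivity) ((div_le_one hdR).2 h2)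
  push_cast
  field_simp
  linarith

theorem cle_iff_resid {d a : ℕ} (hd : 0 < d) (ha : 0 < a) (l : ℕ) (g y : ℤ) :
    cle (((a ^ l : ℕ) : ℝ) * ((g : ℝ) / d)) (((a ^ l : ℕ) : ℝ) * ((y : ℝ) / d)) ↔
      resid d a l g < resid d a l y ∨ (resid d a l g = resid d a l y ∧ y ≤ g) := by
  have hdR : (0 : ℝ) < d := by exact_mod_cast hd
  have haR : (0 : ℝ) < ((a ^ l : ℕ) : ℝ) := by exact_mod_cast pow_pos ha l
  rw [cle, hfrac_pow_mul_div hd, hfrac_pow_mul_div hd, div_lt_div_iff_of_pos_right hdR,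
    div_left_inj' hdR.ne', mul_le_mul_iff_right₀ haR, div_le_div_iff_of_pos_right hdR]
  norm_cast

theorem christol_eq_excess {r s d a : ℕ} (hd : 0 < d) (ha : 0 < a) {α : Fin r → ℚ}
    {β : Fin s → ℚ} {A : Fin r → ℤ} {B : Fin s → ℤ} (hA : ∀ i, α i = (A i : ℚ) / d)
    (hB : ∀ j, β j = (B j : ℚ) / d) (l : ℕ) (y : ℤ) :
    christol α β (((a ^ l : ℕ) : ℝ) * ((y : ℝ) / d)) (a ^ l) = excess A B (fun g =>
      resid d a l g < resid d a l y ∨ (resid d a l g = resid d a l y ∧ y ≤ g)) := by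
  have hA' : ∀ i, (α i : ℝ) = (A i : ℝ) / d := fun i => by rw [hA]; push_cast; rfl
  have hB' : ∀ j, (β j : ℝ) = (B j : ℝ) / d := fun j => by rw [hB]; push_cast; rfl
  simp only [christol, hA', hB', cle_iff_resid hd ha, excess]

theorem den_dvd_dab_left {r s : ℕ} (α : Fin r → ℚ) (β : Fin s → ℚ) (i : Fin r) :
    (α i).den ∣ dab α β :=
  (Finset.dvd_lcm (f := fun i => (α i).den) (Finset.mem_univ i)).trans (Nat.dvd_lcm_left _ _)

theorem den_dvd_dab_right {r s : ℕ} (α : Fin r → ℚ) (β : Fin s → ℚ) (j : Fin s) :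
    (β j).den ∣ dab α β :=
  (Finset.dvd_lcm (f := fun j => (β j).den) (Finset.mem_univ j)).trans (Nat.dvd_lcm_right _ _)

theorem exists_eq_intCast_div {d : ℕ} (hd : 0 < d) {x : ℚ} (h : x.den ∣ d) :
    ∃ g : ℤ, x = (g : ℚ) / d := by
  obtain ⟨c, rfl⟩ := h
  refine ⟨x.num * c, ?_⟩
  have hc : (c : ℚ) ≠ 0 := by
    rintro hc
    simp_all
  push_cast
  rw [mul_div_mul_right _ _ hc, Rat.num_div_den]

theorem admissible_of_eq_div {d p : ℕ} (hd : 0 < d) {x : ℚ} {g : ℤ} (hx : x = (g : ℚ) / d)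
    (hne : ∀ m : ℤ, m ≤ 0 → x ≠ (m : ℚ)) (hb : (p : ℚ) > (d : ℚ) * (2 + 2 * |x|)) :
    Admissible d p g := by
  have hdQ : (0 : ℚ) < d := by exact_mod_cast hd
  constructor
  · have h1 : (d : ℚ) * |x| = |(g : ℚ)| := by
      rw [hx, abs_div, abs_of_pos hdQ]
      field_simp
    have h2 : 2 * (d : ℚ) + 2 * |(g : ℚ)| < p := by
      rw [← h1]
      linarith
    exact_mod_cast h2
  · rintro m hm rfl
    apply hne m hm
    rw [hx]
    push_cast
    field_simp

theorem exists_mab_eq {r s : ℕ} (hr : 0 < r) (α : Fin r → ℚ) (β : Fin s → ℚ) :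
    ∃ m : ℤ, mab α β = m ∧ (∀ i, (m : ℝ) ≤ α i - hfrac (α i)) ∧
      ∀ j, (m : ℝ) ≤ β j - hfrac (β j) := by
  set S : Set ℝ := (fun γ : ℝ => γ - hfrac γ) ''
    (Set.range (fun i => (α i : ℝ)) ∪ Set.range (fun j => (β j : ℝ))) with hS
  have hfin : S.Finite := ((Set.finite_range _).union (Set.finite_range _)).image _
  have hne : S.Nonempty :=
    Set.Nonempty.image _ ⟨_, Or.inl ⟨⟨0, hr⟩, rfl⟩⟩
  obtain ⟨x, -, hx⟩ := hne.csInf_mem hfin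
  have hm : mab α β = ((⌈x⌉ - 1 : ℤ) : ℝ) := by
    rw [mab, ← hS, ← hx]
    simp only [hfrac]
    push_cast
    ring
  refine ⟨⌈x⌉ - 1, hm, fun i => ?_, fun j => ?_⟩ <;> rw [← hm]
  · exact csInf_le hfin.bddBelow ⟨_, Or.inl ⟨i, rfl⟩, rfl⟩
  · exact csInf_le hfin.bddBelow ⟨_, Or.inr ⟨j, rfl⟩, rfl⟩

theorem add_mul_le_of_modEq {d : ℕ} (hd : 0 < d) {e m g : ℤ} (he : 1 ≤ e) (hed : e ≤ d)
    (hge : g ≡ e [ZMOD d]) (hm : (m : ℝ) ≤ (g : ℝ) / d - hfrac ((g : ℝ) / d)) :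
    e + m * d ≤ g := by
  have hdR : (0 : ℝ) < d := by exact_mod_cast hd
  have h1 : hfrac ((g : ℝ) / d) = (e : ℝ) / d := by
    have h2 := hfrac_pow_mul_div hd 1 1 g
    have h3 : resid d 1 1 g = e := (resid_eq_iff hd he hed).2 (by simpa using hge)
    simpa [h3] using h2
  rw [h1, ← sub_div, le_div_iff₀ hdR] at hm
  have : m * d ≤ g - e := by exact_mod_cast hm
  linarith

theorem orderOf_natCast_pos {d p a : ℕ} (hd : 0 < d) (hap : (a : ℤ) * p ≡ 1 [ZMOD d]) :
    0 < orderOf (a : ZMod d) := by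
  have : NeZero d := ⟨hd.ne'⟩
  have h : (a : ZMod d) * p = 1 := by
    have := (ZMod.intCast_eq_intCast_iff _ _ d).2 hap
    simpa using this
  have h1 := orderOf_pos (Units.mkOfMulEqOne _ _ h)
  rwa [← orderOf_units] at h1

theorem pow_orderOf_natCast_modEq (d a : ℕ) :
    (a : ℤ) ^ orderOf (a : ZMod d) ≡ 1 [ZMOD d] := by
  rw [← ZMod.intCast_eq_intCast_iff]
  simp [pow_orderOf_eq_one]

/-- Theorem 1.2(iii): if `r = s`, `p > max(M_{α,β}, 3 s d_{α,β})` is prime, and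
`a ∈ {1,…,d_{α,β}}` satisfies `a p ≡ 1 (mod d_{α,β})`, then `F_{α,β}(z) ∈ ℤ_p[[z]]`
iff (1) `Σ_{l=1}^{h} δ_{α,β}(a^l β_k, a^l) ≥ 0` for all `h ∈ {1,…,ord(a)}`, `k ∈ {1,…,s}`,
and (2) `δ_{α,β}(a^l(e/d_{α,β} + m_{α,β}), a^l) ≥ 0` for all `l ∈ {1,…,ord(a)}`,
`e ∈ {1,…,d_{α,β}}`, where `ord(a)` is the multiplicative order of `a` mod `d_{α,β}`. -/
theorem stmt2 {r s : ℕ} (hr : 0 < r) (hs : 0 < s)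
    (α : Fin r → ℚ) (β : Fin s → ℚ)
    (hα : ∀ i, ∀ m : ℤ, m ≤ 0 → α i ≠ (m : ℚ))
    (hβ : ∀ j, ∀ m : ℤ, m ≤ 0 → β j ≠ (m : ℚ))
    (p : ℕ) (hp : p.Prime)
    (hpM : ∀ i, (p : ℚ) > (dab α β : ℚ) * (2 + 2 * |α i|))
    (hpM' : ∀ j, (p : ℚ) > (dab α β : ℚ) * (2 + 2 * |β j|))
    (hps : (p : ℚ) > 3 * s * (dab α β : ℚ))
    (a : ℕ) (ha1 : 1 ≤ a) (ha2 : a ≤ dab α β)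
    (hamod : a * p ≡ 1 [MOD dab α β])
    (hrs : r = s) :
    (∀ n : ℕ, 0 ≤ padicValRat p (hgCoeff α β n)) ↔
      ((∀ k : Fin s, ∀ h ∈ Finset.Icc 1 (orderOf (a : ZMod (dab α β))),
          0 ≤ ∑ l ∈ Finset.Icc 1 h, christol α β (((a ^ l : ℕ) : ℝ) * (β k : ℝ)) (a ^ l)) ∧
        (∀ l ∈ Finset.Icc 1 (orderOf (a : ZMod (dab α β))),
          ∀ e ∈ Finset.Icc 1 (dab α β),
            0 ≤ christol α β
              (((a ^ l : ℕ) : ℝ) * (((e : ℝ) / (dab α β : ℝ)) + mab α β)) (a ^ l))) := by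
  subst hrs
  obtain ⟨m, hm, hmα, hmβ⟩ := exists_mab_eq hr α β
  have hd : 0 < dab α β := ha1.trans ha2
  have hap : (a : ℤ) * p ≡ 1 [ZMOD dab α β] := by exact_mod_cast Int.natCast_modEq_iff.2 hamod
  choose A hA using fun i => exists_eq_intCast_div hd (den_dvd_dab_left α β i)
  choose B hB using fun j => exists_eq_intCast_div hd (den_dvd_dab_right α β j)
  have hA' := fun i => admissible_of_eq_div hd (hA i) (hα i) (hpM i)
  have hB' := fun j => admissible_of_eq_div hd (hB j) (hβ j) (hpM' j)
  have hchr := christol_eq_excess hd ha1 hA hB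
  set d := dab α β with hd_def
  have hαR : ∀ i, (α i : ℝ) = (A i : ℝ) / d := fun i => by rw [hA]; push_cast; rfl
  have hβR : ∀ j, (β j : ℝ) = (B j : ℝ) / d := fun j => by rw [hB]; push_cast; rfl
  have ho := orderOf_natCast_pos hd hap
  have hper := fun l g => resid_periodic (pow_orderOf_natCast_modEq d a) l g
  set o := orderOf (a : ZMod d)
  have hintegral := hgCoeff_integral_iff hp hd hap hA' hB'
  rw [← funext hA, ← funext hB] at hintegral
  rw [hintegral]
  have hchr1 : ∀ k l, 1 ≤ l → christol α β (((a ^ l : ℕ) : ℝ) * (β k : ℝ)) (a ^ l) =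
      excess A B (fun g => firstZero d p a l g ≤ firstZero d p a l (B k)) := by
    intro k l hl
    rw [hβR, hchr]
    exact excess_congr (fun i => (firstZero_le_iff hd hap hl (hA' i) (hB' k)).symm)
      fun j => (firstZero_le_iff hd hap hl (hB' j) (hB' k)).symm
  have hchr2 : ∀ l (e : ℕ), 1 ≤ e → e ≤ d →
      christol α β (((a ^ l : ℕ) : ℝ) * (((e : ℝ) / (d : ℝ)) + mab α β)) (a ^ l) =
        excess A B (fun g => resid d a l g ≤ resid d a l e) := by
    intro l e he hed
    have hdR : (d : ℝ) ≠ 0 := by positivity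
    have h1 : ((e : ℝ) / (d : ℝ)) + mab α β = ((e + m * d : ℤ) : ℝ) / d := by
      rw [hm]
      push_cast
      field_simp
    have h2 : (e + m * d : ℤ) ≡ e [ZMOD d] := by simp [Int.ModEq]
    have h3 : resid d a l (e + m * d) = resid d a l e :=
      (resid_eq_resid_iff hd hap l _ _).2 h2
    have key : ∀ {g : ℤ}, (m : ℝ) ≤ (g : ℝ) / d - hfrac ((g : ℝ) / d) →
        (resid d a l g < resid d a l e ∨ (resid d a l g = resid d a l e ∧ e + m * d ≤ g) ↔
          resid d a l g ≤ resid d a l e) := by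
      intro g hg
      rw [le_iff_lt_or_eq (a := resid d a l g)]
      refine or_congr_right (and_iff_left_of_imp fun h => ?_)
      exact add_mul_le_of_modEq hd (by exact_mod_cast he) (by exact_mod_cast hed)
        ((resid_eq_resid_iff hd hap l _ _).1 h) hg
    rw [h1, hchr, h3]
    exact excess_congr (fun i => key (hαR i ▸ hmα i)) fun j => key (hβR j ▸ hmβ j)
  refine and_congr (forall_congr' fun k => ?_) ?_
  · have hsum : ∀ h, ∑ l ∈ Finset.Icc 1 h,
        excess A B (fun g => firstZero d p a l g ≤ firstZero d p a l (B k)) =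
          ∑ l ∈ Finset.Icc 1 h, christol α β (((a ^ l : ℕ) : ℝ) * (β k : ℝ)) (a ^ l) :=
      fun h => Finset.sum_congr rfl fun l hl => (hchr1 k l (Finset.mem_Icc.1 hl).1).symm
    simp only [hsum]
    refine ⟨fun h n _ => h n, fun h => sum_Icc_nonneg_of_periodic ho (fun l => ?_) h⟩
    rw [hβR, hchr, hchr]
    simp only [hper]
  · constructor
    · intro h l hl e he
      rw [Finset.mem_Icc] at hl he
      rw [hchr2 l e he.1 he.2]
      exact h l hl.1 _ (resid_pos hd a l e) (resid_le hd a l e)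
    · intro h l hl t ht htd
      have hper' : ∀ c l g, resid d a (l + o * c) g = resid d a l g := by
        intro c l g
        induction c with
        | zero => rfl
        | succ c ih => rw [Nat.mul_succ, ← add_assoc, hper, ih]
      have hl' : (l - 1) % o + 1 + o * ((l - 1) / o) = l := by
        have := Nat.mod_add_div (l - 1) o
        omega
      set l' := (l - 1) % o + 1 with hl'_def
      have hlo : l' ≤ o := Nat.mod_lt _ ho
      have he1 := resid_pos hd p l' t
      have he2 := resid_le hd p l' t
      obtain ⟨e, he⟩ : ∃ e : ℕ, (e : ℤ) = resid d p l' t :=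
        ⟨_, Int.toNat_of_nonneg (by omega)⟩
      have het : resid d a l' e = t := by
        rw [resid_eq_iff hd ht htd, he]
        have h1 := (resid_modEq d p l' t).mul_left ((a : ℤ) ^ l')
        have h2 := (pow_mul_pow_modEq hap l').mul_right t
        rw [one_mul, mul_comm ((p : ℤ) ^ l'), mul_assoc] at h2
        exact h1.trans h2
      have h1 := h l' (Finset.mem_Icc.2 ⟨by omega, hlo⟩) e (Finset.mem_Icc.2 (by omega))
      rw [hchr2 l' e (by omega) (by omega), het] at h1
      rw [← hl']
      simpa only [hper'] using h1
end
end

section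
/- Let p be a prime and let α ∈ ℤ_p be a p-adic integer that is not a nonpositive rational integer. Then for every nonnegative integer n, v_p((α)_n) = Σ_{l=1}^{∞} ⌊(n − 1 + R_{p,l}(α))/p^l⌋ = Σ_{l=1}^{∞} ⌈(n − T_{p,l}(α))/p^l⌉ (both sums have only finitely many nonzero terms). -/
open scoped BigOperators

noncomputable section

variable {p : ℕ} [Fact p.Prime]

/-- `T_{p,l}(α)`: the unique element of `{0,…,p^l−1}` congruent to `−α` modulo `p^l`. -/
def Tpl (α : ℤ_[p]) (l : ℕ) : ℕ := PadicInt.appr (-α) l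

/-- `R_{p,l}(α) = p^l − T_{p,l}(α)`: the unique element of `{1,…,p^l}` congruent to `α`
modulo `p^l`. -/
def Rpl (α : ℤ_[p]) (l : ℕ) : ℕ := p ^ l - Tpl α l

theorem Rat.ceil_intCast_add_one_div (a : ℤ) {q : ℕ} (hq : 0 < q) :
    ⌈((a : ℚ) + 1) / q⌉ = ⌈(a : ℚ) / q⌉ + if (q : ℤ) ∣ a then 1 else 0 := by
  have hq' : (0 : ℤ) < q := by exact_mod_cast hq
  have h := Rat.ceil_intCast_div_natCast (a + 1) q
  push_cast at h
  rw [h, Rat.ceil_intCast_div_natCast]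
  split_ifs with hd
  · obtain ⟨c, rfl⟩ := hd
    have h1 : -((q : ℤ) * c + 1) / q = -c - 1 := by
      rw [Int.ediv_eq_iff_of_pos hq']
      constructor <;> nlinarith
    have h2 : -((q : ℤ) * c) / q = -c := by
      rw [Int.ediv_eq_iff_of_pos hq']
      constructor <;> nlinarith
    rw [h1, h2]
    ring
  · have h1 := Int.emod_add_mul_ediv (-a) q
    have h2 := Int.emod_lt_of_pos (-a) hq'
    have h3 := Int.emod_nonneg (-a) hq'.ne'
    have h4 : (-a) % (q : ℤ) ≠ 0 := fun h0 ↦ hd (Int.dvd_neg.mp (Int.dvd_of_emod_eq_zero h0))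
    have h5 : 0 < (-a) % (q : ℤ) := lt_of_le_of_ne h3 h4.symm
    have h6 : -(a + 1) / (q : ℤ) = -a / q := by
      rw [Int.ediv_eq_iff_of_pos hq']
      constructor <;> nlinarith
    rw [h6, add_zero]

theorem Rat.floor_intCast_add_sub_one_div (a : ℤ) {q : ℕ} (hq : 0 < q) :
    ⌊((a : ℚ) - 1 + q) / q⌋ = ⌈(a : ℚ) / q⌉ := by
  have hq' : (0 : ℚ) < q := by exact_mod_cast hq
  rw [Int.floor_eq_iff]
  set c := ⌈(a : ℚ) / q⌉ with hc
  obtain ⟨h1, h2⟩ := Int.ceil_eq_iff.mp hc.symm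
  rw [lt_div_iff₀ hq'] at h1
  rw [div_le_iff₀ hq'] at h2
  have h1' : (c - 1) * (q : ℤ) + 1 ≤ a := by
    have : (c - 1) * (q : ℤ) < a := by exact_mod_cast h1
    linarith
  have h1'' : ((c : ℚ) - 1) * q + 1 ≤ a := by exact_mod_cast h1'
  rw [le_div_iff₀ hq', div_lt_iff₀ hq']
  constructor <;> linarith

theorem Finset.sum_Icc_one_ite_le {v L : ℕ} (h : v ≤ L) :
    ∑ l ∈ Finset.Icc 1 L, (if l ≤ v then (1 : ℤ) else 0) = v := by
  have : (Finset.Icc 1 L).filter (· ≤ v) = Finset.Icc 1 v := by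
    ext l
    simp only [Finset.mem_filter, Finset.mem_Icc]
    lia
  rw [← Finset.sum_filter, this]
  simp

theorem Tpl_lt (α : ℤ_[p]) (l : ℕ) : Tpl α l < p ^ l := PadicInt.appr_lt _ _

theorem pow_dvd_sub_Tpl_iff (α : ℤ_[p]) (n l : ℕ) (h : α + n ≠ 0) :
    ((p ^ l : ℕ) : ℤ) ∣ (n : ℤ) - Tpl α l ↔ l ≤ (α + n).valuation := by
  have hT := Ideal.mem_span_singleton.mp (PadicInt.appr_spec l (-α))
  have hcast := PadicInt.pow_p_dvd_int_iff (p := p) l ((n : ℤ) - Tpl α l)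
  have heq : (n : ℤ_[p]) - Tpl α l = α + n + (-α - (-α).appr l) := by
    simp only [Tpl]
    ring
  rw [← PadicInt.mem_span_pow_iff_le_valuation _ h, Ideal.mem_span_singleton, Nat.cast_pow,
    ← hcast]
  push_cast
  rw [heq, dvd_add_left hT]

theorem ceil_succ_sub_Tpl_div (α : ℤ_[p]) (n l : ℕ) (h : α + n ≠ 0) :
    ⌈(((n + 1 : ℕ) : ℚ) - Tpl α l) / (p : ℚ) ^ l⌉ =
      ⌈((n : ℚ) - Tpl α l) / (p : ℚ) ^ l⌉ + if l ≤ (α + n).valuation then 1 else 0 := by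
  have hp : 0 < p ^ l := pow_pos (Fact.out : p.Prime).pos l
  have := Rat.ceil_intCast_add_one_div ((n : ℤ) - Tpl α l) hp
  simp only [pow_dvd_sub_Tpl_iff α n l h] at this
  push_cast at this ⊢
  rw [← this]
  congr 2
  ring

theorem floor_Rpl_eq_ceil_Tpl (α : ℤ_[p]) (n l : ℕ) :
    ⌊((n : ℚ) - 1 + Rpl α l) / (p : ℚ) ^ l⌋ = ⌈((n : ℚ) - Tpl α l) / (p : ℚ) ^ l⌉ := by
  have hp : 0 < p ^ l := pow_pos (Fact.out : p.Prime).pos l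
  have := Rat.floor_intCast_add_sub_one_div ((n : ℤ) - Tpl α l) hp
  rw [Rpl, Nat.cast_sub (Tpl_lt α l).le]
  push_cast at this ⊢
  rw [← this]
  congr 2
  ring

theorem ceil_neg_Tpl_div (α : ℤ_[p]) (l : ℕ) :
    ⌈(((0 : ℕ) : ℚ) - Tpl α l) / (p : ℚ) ^ l⌉ = 0 := by
  have hp : (0 : ℚ) < (p : ℚ) ^ l := by
    exact_mod_cast pow_pos (Fact.out : p.Prime).pos l
  have hT : (Tpl α l : ℚ) < (p : ℚ) ^ l := by exact_mod_cast Tpl_lt α l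
  have hT0 : (0 : ℚ) ≤ Tpl α l := Nat.cast_nonneg _
  rw [Int.ceil_eq_iff, lt_div_iff₀ hp, div_le_iff₀ hp]
  push_cast
  constructor <;> linarith

theorem exists_valuation_ascPochhammer_eq_sum_ceil (α : ℤ_[p])
    (hα : ∀ n : ℕ, α + n ≠ 0) (n : ℕ) :
    (ascPochhammer ℤ_[p] n).eval α ≠ 0 ∧ ∃ L0 : ℕ,
      (∀ l > L0, ⌈((n : ℚ) - Tpl α l) / (p : ℚ) ^ l⌉ = 0) ∧
      ∀ L ≥ L0, ((ascPochhammer ℤ_[p] n).eval α).valuation =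
        ∑ l ∈ Finset.Icc 1 L, ⌈((n : ℚ) - Tpl α l) / (p : ℚ) ^ l⌉ := by
  induction n with
  | zero =>
    refine ⟨by simp, 0, fun l _ ↦ ceil_neg_Tpl_div α l, fun L _ ↦ ?_⟩
    rw [Finset.sum_eq_zero fun l _ ↦ ceil_neg_Tpl_div α l]
    simp
  | succ n ih =>
    obtain ⟨hne, L0, hzero, hsum⟩ := ih
    rw [ascPochhammer_succ_eval]
    refine ⟨mul_ne_zero hne (hα n), max L0 (α + n).valuation, fun l hl ↦ ?_, fun L hL ↦ ?_⟩
    · rw [ceil_succ_sub_Tpl_div α n l (hα n), hzero l (by lia), if_neg (by lia), add_zero]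
    · rw [PadicInt.valuation_mul hne (hα n), Nat.cast_add, hsum L (by lia),
        Finset.sum_congr rfl fun l _ ↦ ceil_succ_sub_Tpl_div α n l (hα n),
        Finset.sum_add_distrib, Finset.sum_Icc_one_ite_le (by lia)]

/-- Lemma 2.1: for `α ∈ ℤ_p` not a nonpositive rational integer and any `n ≥ 0`,
`v_p((α)_n) = Σ_{l≥1} ⌊(n−1+R_{p,l}(α))/p^l⌋ = Σ_{l≥1} ⌈(n−T_{p,l}(α))/p^l⌉`,
both sums having only finitely many nonzero terms. -/
theorem stmt7 (α : ℤ_[p]) (hα : ∀ m : ℤ, m ≤ 0 → α ≠ (m : ℤ_[p])) (n : ℕ) :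
    {l : ℕ | 1 ≤ l ∧ ⌊((n : ℚ) - 1 + (Rpl α l : ℚ)) / (p : ℚ) ^ l⌋ ≠ 0}.Finite ∧
      {l : ℕ | 1 ≤ l ∧ ⌈((n : ℚ) - (Tpl α l : ℚ)) / (p : ℚ) ^ l⌉ ≠ 0}.Finite ∧
      ∃ L0 : ℕ, ∀ L ≥ L0,
        ((ascPochhammer ℤ_[p] n).eval α).valuation =
            ∑ l ∈ Finset.Icc 1 L, ⌊((n : ℚ) - 1 + (Rpl α l : ℚ)) / (p : ℚ) ^ l⌋ ∧
          ((ascPochhammer ℤ_[p] n).eval α).valuation =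
            ∑ l ∈ Finset.Icc 1 L, ⌈((n : ℚ) - (Tpl α l : ℚ)) / (p : ℚ) ^ l⌉ := by
  have hne (m : ℕ) : α + m ≠ 0 := fun h ↦
    hα (-m) (by simp) (by push_cast; exact eq_neg_of_add_eq_zero_left h)
  obtain ⟨-, L0, hzero, hsum⟩ := exists_valuation_ascPochhammer_eq_sum_ceil α hne n
  have hfin : {l : ℕ | 1 ≤ l ∧ ⌈((n : ℚ) - (Tpl α l : ℚ)) / (p : ℚ) ^ l⌉ ≠ 0}.Finite :=
    (Set.finite_Iic L0).subset fun l hl ↦ not_lt.mp fun h ↦ hl.2 (hzero l h)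
  simp only [floor_Rpl_eq_ceil_Tpl]
  exact ⟨hfin, hfin, L0, fun L hL ↦ ⟨hsum L hL, hsum L hL⟩⟩
end
end

section
/- Let γ_1, γ_2 ∈ ℚ∖ℤ_{≤0}. (i) If ⟨bγ_1⟩ = ⟨bγ_2⟩ for some positive integer b coprime to lcm(d(γ_1), d(γ_2)), then ⟨aγ_1⟩ = ⟨aγ_2⟩ for every positive integer a. (ii) If p is a prime with p ≥ max(d(γ_1)(|⌊1−γ_1⌋| + ⟨γ_1⟩), d(γ_2)(|⌊1−γ_2⌋| + ⟨γ_2⟩)), then 𝔇_p^L(γ_1) = 𝔇_p^L(γ_2) holds for one given positive integer L if and only if 𝔇_p^l(γ_1) = 𝔇_p^l(γ_2) holds for all positive integers l. -/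
noncomputable section

/-- `hfracQ x` is `⟨x⟩`, the unique element of `(0,1]` with `x - ⟨x⟩ ∈ ℤ`. -/
def hfracQ (x : ℚ) : ℚ := x - ⌈x⌉ + 1

/-- `T_{p,l}(γ)` for a rational `γ` with `p ∤ den(γ)`: the unique element of
`{0,…,p^l−1}` congruent to `−γ` modulo `p^l` (computed via `ZMod (p^l)`). -/
def Tnum (p l : ℕ) (γ : ℚ) : ℕ :=
  ((((-γ.num : ℤ) : ZMod (p ^ l)) * ((γ.den : ZMod (p ^ l)))⁻¹)).val

/-- The `l`-th iterate `𝔇_p^l(γ)` of the Dwork map of a rational `γ ∈ ℤ_p`: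
the unique `δ` with `p^l·δ − γ ∈ {0,…,p^l−1}`, i.e. `δ = (γ + T_{p,l}(γ))/p^l`. -/
def dworkIter (p l : ℕ) (γ : ℚ) : ℚ := (γ + (Tnum p l γ : ℚ)) / (p : ℚ) ^ l

theorem exists_int_eq_of_coprime_mul {m n : ℕ} (h : m.Coprime n) {x : ℚ}
    (hm : ∃ k : ℤ, (m : ℚ) * x = k) (hn : ∃ k : ℤ, (n : ℚ) * x = k) : ∃ k : ℤ, x = k := by
  obtain ⟨u, hu⟩ := hm
  obtain ⟨v, hv⟩ := hn
  have hb : (m : ℤ) * m.gcdA n + n * m.gcdB n = 1 := by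
    rw [← Nat.gcd_eq_gcd_ab, h.gcd_eq_one]; rfl
  have hb' : (m : ℚ) * (m.gcdA n : ℚ) + n * (m.gcdB n : ℚ) = 1 := by exact_mod_cast hb
  refine ⟨u * m.gcdA n + v * m.gcdB n, ?_⟩
  push_cast
  rw [← hu, ← hv]
  linear_combination (-x) * hb'

theorem hfracQ_eq_iff (x y : ℚ) : hfracQ x = hfracQ y ↔ ∃ k : ℤ, x - y = k := by
  unfold hfracQ
  constructor
  · intro h
    exact ⟨⌈x⌉ - ⌈y⌉, by push_cast; linarith⟩
  · rintro ⟨k, hk⟩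
    obtain rfl : x = y + k := by linarith
    rw [Int.ceil_add_intCast]
    push_cast
    ring

theorem hfracQ_pos (x : ℚ) : 0 < hfracQ x := by
  unfold hfracQ
  linarith [Int.ceil_lt_add_one x]

theorem hfracQ_le_one (x : ℚ) : hfracQ x ≤ 1 := by
  unfold hfracQ
  linarith [Int.le_ceil x]

theorem Tnum_lt {p l : ℕ} (hp : p.Prime) (γ : ℚ) : Tnum p l γ < p ^ l := by
  have : NeZero (p ^ l) := ⟨(pow_pos hp.pos l).ne'⟩
  exact ZMod.val_lt _

theorem pow_dvd_num_add_den_mul_Tnum {p : ℕ} (l : ℕ) (hp : p.Prime) {γ : ℚ}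
    (hd : ¬ p ∣ γ.den) : ((p ^ l : ℕ) : ℤ) ∣ γ.num + γ.den * Tnum p l γ := by
  have : NeZero (p ^ l) := ⟨(pow_pos hp.pos l).ne'⟩
  have hc : γ.den.Coprime (p ^ l) :=
    (Nat.Coprime.pow_left l ((Nat.Prime.coprime_iff_not_dvd hp).2 hd)).symm
  rw [← ZMod.intCast_zmod_eq_zero_iff_dvd]
  push_cast
  unfold Tnum
  rw [ZMod.natCast_zmod_val]
  push_cast
  linear_combination (-(γ.num : ZMod (p ^ l))) * ZMod.coe_mul_inv_eq_one γ.den hc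

theorem pow_mul_dworkIter {p : ℕ} (l : ℕ) (hp : p.Prime) (γ : ℚ) :
    ((p ^ l : ℕ) : ℚ) * dworkIter p l γ = γ + Tnum p l γ := by
  have : (p : ℚ) ^ l ≠ 0 := pow_ne_zero _ (by exact_mod_cast hp.ne_zero)
  unfold dworkIter
  push_cast
  field_simp

theorem exists_int_den_mul_dworkIter {p : ℕ} (l : ℕ) (hp : p.Prime) {γ : ℚ}
    (hd : ¬ p ∣ γ.den) : ∃ k : ℤ, (γ.den : ℚ) * dworkIter p l γ = k := by
  obtain ⟨k, hk⟩ := pow_dvd_num_add_den_mul_Tnum l hp hd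
  refine ⟨k, ?_⟩
  have hne : ((p ^ l : ℕ) : ℚ) ≠ 0 := by exact_mod_cast (pow_pos hp.pos l).ne'
  have hk' : (γ.num : ℚ) + γ.den * Tnum p l γ = ((p ^ l : ℕ) : ℚ) * k := by exact_mod_cast hk
  apply mul_left_cancel₀ hne
  linear_combination hk' + (γ.den : ℚ) * pow_mul_dworkIter l hp γ + Rat.den_mul_eq_num γ

theorem dworkIter_pos_and_le_one {p l : ℕ} (hl : 0 < l) (hp : p.Prime) {γ : ℚ}
    (hd : ¬ p ∣ γ.den) (hγ : ∀ m : ℤ, m ≤ 0 → γ ≠ (m : ℚ))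
    (hb : (γ.den : ℚ) * (|(⌊(1 : ℚ) - γ⌋ : ℚ)| + hfracQ γ) ≤ p) :
    0 < dworkIter p l γ ∧ dworkIter p l γ ≤ 1 := by
  obtain ⟨k, hk⟩ := exists_int_den_mul_dworkIter l hp hd
  have hmul := pow_mul_dworkIter l hp γ
  have hT : (Tnum p l γ : ℚ) + 1 ≤ (p ^ l : ℕ) := by exact_mod_cast Tnum_lt hp γ
  have hT0 : (0 : ℚ) ≤ Tnum p l γ := by positivity
  have hP : (0 : ℚ) < (p ^ l : ℕ) := by exact_mod_cast pow_pos hp.pos l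
  have hpP : (p : ℚ) ≤ (p ^ l : ℕ) := by exact_mod_cast Nat.le_self_pow hl.ne' p
  have hd1 : (0 : ℚ) < γ.den := by exact_mod_cast γ.den_pos
  have hf := hfracQ_pos γ
  have hfloor : (⌊(1 : ℚ) - γ⌋ : ℚ) = hfracQ γ - γ := by
    have : ⌊(1 : ℚ) - γ⌋ = 1 - ⌈γ⌉ := by
      rw [sub_eq_add_neg, ← Nat.cast_one, Int.floor_natCast_add, Int.floor_neg]
      push_cast
      ring
    rw [this]
    unfold hfracQ
    push_cast
    ring
  rw [hfloor] at hb
  have hup : (γ.den : ℚ) * γ ≤ p :=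
    (mul_le_mul_of_nonneg_left (by linarith [neg_abs_le (hfracQ γ - γ)]) hd1.le).trans hb
  have hlo : -(p : ℚ) < γ.den * γ := by
    have : (γ.den : ℚ) * (-γ) < γ.den * (|hfracQ γ - γ| + hfracQ γ) :=
      mul_lt_mul_of_pos_left (by linarith [le_abs_self (hfracQ γ - γ)]) hd1
    linarith
  have hkP : ((p ^ l : ℕ) : ℚ) * k = γ.den * γ + γ.den * Tnum p l γ := by
    rw [← hk]
    linear_combination (γ.den : ℚ) * hmul
  have hk_nonneg : 0 ≤ k := by
    have : (-1 : ℚ) < k := by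
      refine lt_of_mul_lt_mul_left ?_ hP.le
      linarith [mul_nonneg hd1.le hT0]
    have : (-1 : ℤ) < k := by exact_mod_cast this
    omega
  have hk_le : k ≤ γ.den := by
    have : (k : ℚ) < γ.den + 1 := by
      refine lt_of_mul_lt_mul_left ?_ hP.le
      linarith [mul_le_mul_of_nonneg_left hT hd1.le]
    have : k < (γ.den : ℤ) + 1 := by exact_mod_cast this
    omega
  have hk0 : k ≠ 0 := by
    rintro rfl
    apply hγ (-(Tnum p l γ : ℤ)) (by omega)
    have : (γ.den : ℚ) * (γ + Tnum p l γ) = 0 := by rw [mul_add, ← hkP]; simp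
    push_cast
    linarith [(mul_eq_zero.1 this).resolve_left hd1.ne']
  have hk_pos : (0 : ℚ) < k := by exact_mod_cast lt_of_le_of_ne hk_nonneg hk0.symm
  have hk_le' : (k : ℚ) ≤ γ.den := by exact_mod_cast hk_le
  constructor
  · exact pos_of_mul_pos_right (hk ▸ hk_pos) hd1.le
  · exact le_of_mul_le_mul_left (by linarith) hd1

theorem hfracQ_eq_self {x : ℚ} (h0 : 0 < x) (h1 : x ≤ 1) : hfracQ x = x := by
  have : ⌈x⌉ = 1 := Int.ceil_eq_iff.2 ⟨by simpa using h0, by simpa using h1⟩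
  simp [hfracQ, this]

theorem exists_int_mul_of_den_dvd {γ x : ℚ} {n : ℕ} (h : γ.den ∣ n)
    (hx : ∃ k : ℤ, (γ.den : ℚ) * x = k) : ∃ k : ℤ, (n : ℚ) * x = k := by
  obtain ⟨c, rfl⟩ := h
  obtain ⟨k, hk⟩ := hx
  exact ⟨c * k, by push_cast; rw [← hk]; ring⟩

theorem exists_int_mul_sub {n x y : ℚ} (hx : ∃ k : ℤ, n * x = k) (hy : ∃ k : ℤ, n * y = k) :
    ∃ k : ℤ, n * (x - y) = k := by
  obtain ⟨u, hu⟩ := hx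
  obtain ⟨v, hv⟩ := hy
  exact ⟨u - v, by push_cast; rw [← hu, ← hv]; ring⟩

/-- Lemma 2.4: for `γ₁, γ₂ ∈ ℚ∖ℤ_{≤0}`:
(i) if `⟨bγ₁⟩ = ⟨bγ₂⟩` for some positive `b` coprime to `lcm(d(γ₁), d(γ₂))`, then
`⟨aγ₁⟩ = ⟨aγ₂⟩` for every positive integer `a`;
(ii) if `p` is a prime not dividing either denominator with
`p ≥ max(d(γ₁)(|⌊1−γ₁⌋| + ⟨γ₁⟩), d(γ₂)(|⌊1−γ₂⌋| + ⟨γ₂⟩))`, then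
`𝔇_p^L(γ₁) = 𝔇_p^L(γ₂)` for a given positive `L` iff `𝔇_p^l(γ₁) = 𝔇_p^l(γ₂)` for all
positive `l`. -/
theorem stmt9 (γ1 γ2 : ℚ)
    (h1 : ∀ m : ℤ, m ≤ 0 → γ1 ≠ (m : ℚ)) (h2 : ∀ m : ℤ, m ≤ 0 → γ2 ≠ (m : ℚ)) :
    (∀ b : ℕ, 0 < b → b.Coprime (Nat.lcm γ1.den γ2.den) →
        hfracQ ((b : ℚ) * γ1) = hfracQ ((b : ℚ) * γ2) →
      ∀ a : ℕ, 0 < a → hfracQ ((a : ℚ) * γ1) = hfracQ ((a : ℚ) * γ2)) ∧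
    (∀ p : ℕ, p.Prime → ¬ (p ∣ γ1.den) → ¬ (p ∣ γ2.den) →
      (p : ℚ) ≥ max ((γ1.den : ℚ) * (|(⌊(1 : ℚ) - γ1⌋ : ℚ)| + hfracQ γ1))
        ((γ2.den : ℚ) * (|(⌊(1 : ℚ) - γ2⌋ : ℚ)| + hfracQ γ2)) →
      ∀ L : ℕ, 0 < L →
        (dworkIter p L γ1 = dworkIter p L γ2 ↔
          ∀ l : ℕ, 0 < l → dworkIter p l γ1 = dworkIter p l γ2)) := by
  refine ⟨fun b _ hb heq a _ => ?_, fun p hp hd1 hd2 hbound L hL => ⟨fun heq l hl => ?_,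
    fun h => h L hL⟩⟩
  · rw [hfracQ_eq_iff, ← mul_sub] at heq
    rw [hfracQ_eq_iff, ← mul_sub]
    have hlcm := exists_int_mul_sub
      (exists_int_mul_of_den_dvd (Nat.dvd_lcm_left γ1.den γ2.den) ⟨_, Rat.den_mul_eq_num γ1⟩)
      (exists_int_mul_of_den_dvd (Nat.dvd_lcm_right γ1.den γ2.den) ⟨_, Rat.den_mul_eq_num γ2⟩)
    obtain ⟨k, hk⟩ := exists_int_eq_of_coprime_mul hb heq hlcm
    exact ⟨a * k, by rw [hk]; push_cast; rfl⟩
  · have hγ : γ1 - γ2 = ((Tnum p L γ2 - Tnum p L γ1 : ℤ) : ℚ) := by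
      have e1 := pow_mul_dworkIter L hp γ1
      have e2 := pow_mul_dworkIter L hp γ2
      rw [heq] at e1
      push_cast
      linarith
    obtain ⟨pos1, le1⟩ := dworkIter_pos_and_le_one hl hp hd1 h1 ((le_max_left _ _).trans hbound)
    obtain ⟨pos2, le2⟩ := dworkIter_pos_and_le_one hl hp hd2 h2 ((le_max_right _ _).trans hbound)
    rw [← hfracQ_eq_self pos1 le1, ← hfracQ_eq_self pos2 le2, hfracQ_eq_iff]
    have hc : (p ^ l).Coprime (Nat.lcm γ1.den γ2.den) :=
      Nat.Coprime.pow_left l ((Nat.Prime.coprime_iff_not_dvd hp).2 fun h =>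
        ((hp.dvd_mul).1 (h.trans (Nat.lcm_dvd_mul _ _))).elim hd1 hd2)
    refine exists_int_eq_of_coprime_mul hc ?_ (exists_int_mul_sub
      (exists_int_mul_of_den_dvd (Nat.dvd_lcm_left _ _) (exists_int_den_mul_dworkIter l hp hd1))
      (exists_int_mul_of_den_dvd (Nat.dvd_lcm_right _ _) (exists_int_den_mul_dworkIter l hp hd2)))
    refine ⟨Tnum p L γ2 - Tnum p L γ1 + Tnum p l γ1 - Tnum p l γ2, ?_⟩
    rw [mul_sub, pow_mul_dworkIter l hp, pow_mul_dworkIter l hp]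
    push_cast at hγ ⊢
    linarith
end
end

section
/- Let f(z) ∈ ℤ[z] be a polynomial such that f(k) ≠ 0 for every nonnegative integer k. Then for every prime p there exists a positive real constant C (depending on f and p) such that v_p(∏_{k=0}^{n−1} f(k)) ≤ C·n for all positive integers n. -/
open scoped BigOperators

section PadicNorm

variable {p : ℕ} [Fact p.Prime]

theorem Padic.norm_intCast_eq_pow_padicValInt {z : ℤ} (hz : z ≠ 0) :
    ‖(z : ℚ_[p])‖ = ((p : ℝ)⁻¹) ^ padicValInt p z := by
  rw [Padic.norm_eq_zpow_neg_valuation (by exact_mod_cast hz), Padic.valuation_intCast,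
    zpow_neg, zpow_natCast, inv_pow]

theorem Padic.inv_abs_le_norm_intCast {z : ℤ} (hz : z ≠ 0) :
    (|(z : ℝ)|)⁻¹ ≤ ‖(z : ℚ_[p])‖ := by
  have hp : (0 : ℝ) < p := by exact_mod_cast (Fact.out : p.Prime).pos
  rw [Padic.norm_intCast_eq_pow_padicValInt hz, inv_pow]
  apply inv_anti₀ (by positivity)
  have h := Int.le_of_dvd (abs_pos.mpr hz) ((dvd_abs _ _).mpr (padicValInt_dvd (p := p) z))
  exact_mod_cast h

theorem Padic.inv_pow_le_norm_factorial (n : ℕ) :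
    ((p : ℝ)⁻¹) ^ n ≤ ‖((n.factorial : ℤ) : ℚ_[p])‖ := by
  have hp : (1 : ℝ) ≤ p := by exact_mod_cast (Fact.out : p.Prime).one_le
  rw [Padic.norm_intCast_eq_pow_padicValInt (by exact_mod_cast n.factorial_ne_zero),
    padicValInt.of_nat]
  exact pow_le_pow_of_le_one (by positivity) (inv_le_one_of_one_le₀ hp)
    (padicValNat_factorial_le p n)

theorem Padic.norm_intCast_eq_norm_algebra (K : Type*) [NormedField K] [NormedAlgebra ℚ_[p] K]
    (z : ℤ) : ‖(z : K)‖ = ‖(z : ℚ_[p])‖ := by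
  rw [← map_intCast (algebraMap ℚ_[p] K), norm_algebraMap']

end PadicNorm

theorem Polynomial.exists_abs_eval_natCast_le_pow (f : Polynomial ℤ) :
    ∃ B : ℝ, 1 ≤ B ∧ ∀ k : ℕ, |((f.eval (k : ℤ) : ℤ) : ℝ)| ≤ B ^ (k + 1) := by
  induction f using Polynomial.induction_on' with
  | add f g hf hg =>
    obtain ⟨A, hA, hA'⟩ := hf
    obtain ⟨B, hB, hB'⟩ := hg
    refine ⟨A + B, by linarith, fun k => ?_⟩
    rw [Polynomial.eval_add, Int.cast_add]
    calc _ ≤ A ^ (k + 1) + B ^ (k + 1) := (abs_add_le _ _).trans (add_le_add (hA' k) (hB' k))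
      _ ≤ (A + B) ^ (k + 1) :=
        pow_add_pow_le (by linarith) (by linarith) (Nat.succ_ne_zero k)
  | monomial i a =>
    have h2 : (1 : ℝ) ≤ 2 ^ i := one_le_pow₀ (by norm_num)
    have ha : (1 : ℝ) ≤ |(a : ℝ)| + 1 := by linarith [abs_nonneg (a : ℝ)]
    refine ⟨(|(a : ℝ)| + 1) * 2 ^ i, one_le_mul_of_one_le_of_one_le ha h2, fun k => ?_⟩
    have hk : (k : ℝ) ≤ 2 ^ (k + 1) := by
      exact_mod_cast ((Nat.lt_succ_self k).trans Nat.lt_two_pow_self).le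
    simp only [Polynomial.eval_monomial, Int.cast_mul, Int.cast_pow, Int.cast_natCast, abs_mul,
      abs_pow, Nat.abs_cast, mul_pow]
    rw [pow_right_comm]
    gcongr
    exact (le_add_of_nonneg_right zero_le_one).trans (le_self_pow₀ ha (Nat.succ_ne_zero k))

section Ultrametric

variable {K : Type*} [NormedField K]

theorem norm_natCast_le_one_of_padicAlgebra (p : ℕ) [Fact p.Prime] [NormedAlgebra ℚ_[p] K]
    (k : ℕ) : ‖(k : K)‖ ≤ 1 := by
  rw [← Int.cast_natCast, Padic.norm_intCast_eq_norm_algebra (p := p)]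
  exact Padic.norm_int_le_one _

theorem Polynomial.exists_norm_eval_natCast_le (p : ℕ) [Fact p.Prime] [NormedAlgebra ℚ_[p] K]
    (g : Polynomial K) :
    ∃ M : ℝ, 0 < M ∧ ∀ k : ℕ, ‖g.eval (k : K)‖ ≤ M := by
  induction g using Polynomial.induction_on' with
  | add f g hf hg =>
    obtain ⟨A, hA, hA'⟩ := hf
    obtain ⟨B, hB, hB'⟩ := hg
    refine ⟨A + B, by linarith, fun k => ?_⟩
    rw [Polynomial.eval_add]
    exact (norm_add_le _ _).trans (add_le_add (hA' k) (hB' k))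
  | monomial i a =>
    refine ⟨‖a‖ + 1, by positivity, fun k => ?_⟩
    rw [Polynomial.eval_monomial, norm_mul, norm_pow]
    have h := pow_le_one₀ (n := i) (norm_nonneg _)
      (norm_natCast_le_one_of_padicAlgebra p (K := K) k)
    nlinarith [norm_nonneg a]

/-- A `p`-adic root of an integer polynomial without natural zeros is at least exponentially far
from the natural numbers. -/
theorem exists_pow_le_norm_natCast_sub_root (p : ℕ) [Fact p.Prime] [NormedAlgebra ℚ_[p] K]
    {f : Polynomial ℤ}
    (hf : ∀ k : ℕ, f.eval (k : ℤ) ≠ 0) {α : K}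
    (hα : (f.map (Int.castRingHom K)).IsRoot α) :
    ∃ D : ℝ, 0 < D ∧ D ≤ 1 ∧ ∀ k : ℕ, D ^ (k + 1) ≤ ‖(k : K) - α‖ := by
  obtain ⟨g, hg⟩ := Polynomial.dvd_iff_isRoot.mpr hα
  obtain ⟨M, hM, hgM⟩ := Polynomial.exists_norm_eval_natCast_le p g
  obtain ⟨B, hB, hfB⟩ := f.exists_abs_eval_natCast_le_pow
  have hM1 : 1 ≤ M + 1 := by linarith
  refine ⟨(B * (M + 1))⁻¹, by positivity,
    inv_le_one_of_one_le₀ (one_le_mul_of_one_le_of_one_le hB hM1), fun k => ?_⟩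
  have hfk : ((f.eval (k : ℤ) : ℤ) : K) = (k - α) * g.eval (k : K) := by
    have h := congrArg (Polynomial.eval (k : K)) hg
    rw [Polynomial.eval_mul, Polynomial.eval_sub, Polynomial.eval_X, Polynomial.eval_C] at h
    rw [← h, Polynomial.eval_natCast_map, eq_intCast]
  have hlow : (B ^ (k + 1))⁻¹ ≤ ‖(k : K) - α‖ * ‖g.eval (k : K)‖ := by
    rw [← norm_mul, ← hfk, Padic.norm_intCast_eq_norm_algebra (p := p)]
    refine le_trans (inv_anti₀ ?_ (hfB k)) (Padic.inv_abs_le_norm_intCast (hf k))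
    exact abs_pos.mpr (by exact_mod_cast hf k)
  have hup : ‖(k : K) - α‖ * ‖g.eval (k : K)‖ ≤ ‖(k : K) - α‖ * (M + 1) ^ (k + 1) := by
    gcongr
    exact (hgM k).trans ((by linarith : M ≤ M + 1).trans (le_self_pow₀ hM1 (Nat.succ_ne_zero k)))
  rw [inv_pow, mul_pow, mul_inv, ← div_eq_mul_inv, div_le_iff₀ (by positivity)]
  exact hlow.trans hup

/-- The product of the differences between `j` and the other natural numbers below `j + m + 1`
is `± j! * m!`, hence not too small `p`-adically. -/
theorem inv_pow_le_prod_norm_natCast_sub (p : ℕ) [Fact p.Prime] [NormedAlgebra ℚ_[p] K]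
    (j m : ℕ) :
    ((p : ℝ)⁻¹) ^ (j + m) ≤
      (∏ k ∈ Finset.range j, ‖(k : K) - j‖) *
        ∏ i ∈ Finset.range m, ‖((j + (i + 1) : ℕ) : K) - j‖ := by
  have h₁ : ∏ k ∈ Finset.range j, ‖(k : K) - j‖ = ‖((j.factorial : ℤ) : ℚ_[p])‖ := by
    rw [← Padic.norm_intCast_eq_norm_algebra K, ← Finset.prod_range_add_one_eq_factorial,
      ← Finset.prod_range_reflect]
    push_cast
    rw [norm_prod]
    refine Finset.prod_congr rfl fun k hk => ?_
    have hk := Finset.mem_range.mp hk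
    rw [norm_sub_rev, Nat.cast_sub (by omega), Nat.cast_sub (by omega)]
    congr 1
    push_cast
    ring
  have h₂ : ∏ i ∈ Finset.range m, ‖((j + (i + 1) : ℕ) : K) - j‖
      = ‖((m.factorial : ℤ) : ℚ_[p])‖ := by
    rw [← Padic.norm_intCast_eq_norm_algebra K, ← Finset.prod_range_add_one_eq_factorial]
    push_cast
    rw [norm_prod]
    simp
  rw [h₁, h₂, pow_add]
  gcongr <;> exact Padic.inv_pow_le_norm_factorial _

theorem exists_pow_le_prod_norm_natCast_sub (p : ℕ) [Fact p.Prime] [NormedAlgebra ℚ_[p] K]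
    [IsUltrametricDist K] {α : K} {D : ℝ} (hD : 0 < D) (hD1 : D ≤ 1)
    (hα : ∀ k : ℕ, D ^ (k + 1) ≤ ‖(k : K) - α‖) :
    ∃ E : ℝ, 0 < E ∧ ∀ n : ℕ, E ^ n ≤ ∏ k ∈ Finset.range n, ‖(k : K) - α‖ := by
  have hp : (0 : ℝ) < p := by exact_mod_cast (Fact.out : p.Prime).pos
  have hp1 : (p : ℝ)⁻¹ ≤ 1 :=
    inv_le_one_of_one_le₀ (by exact_mod_cast (Fact.out : p.Prime).one_le)
  refine ⟨(p : ℝ)⁻¹ * D, by positivity, fun n => ?_⟩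
  rcases Nat.eq_zero_or_pos n with rfl | hn
  · simp
  obtain ⟨j, hj, hmin⟩ := Finset.exists_min_image (Finset.range n) (fun k => ‖(k : K) - α‖)
    ⟨0, Finset.mem_range.mpr hn⟩
  obtain ⟨m, rfl⟩ := Nat.exists_eq_add_of_lt (Finset.mem_range.mp hj)
  have hle : ∀ k ∈ Finset.range (j + m + 1), ‖(k : K) - j‖ ≤ ‖(k : K) - α‖ := fun k hk => by
    have h := dist_triangle_max (k : K) α j
    rw [dist_eq_norm, dist_eq_norm, dist_comm, dist_eq_norm, max_eq_left (hmin k hk)] at h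
    exact h
  have hleft : ∏ k ∈ Finset.range j, ‖(k : K) - j‖ ≤ ∏ k ∈ Finset.range j, ‖(k : K) - α‖ :=
    Finset.prod_le_prod (fun _ _ => norm_nonneg _) fun k hk =>
      hle k (by simp at hk ⊢; omega)
  have hright : ∏ i ∈ Finset.range m, ‖((j + (i + 1) : ℕ) : K) - j‖
      ≤ ∏ i ∈ Finset.range m, ‖((j + (i + 1) : ℕ) : K) - α‖ :=
    Finset.prod_le_prod (fun _ _ => norm_nonneg _) fun i hi =>
      hle _ (by simp at hi ⊢; omega)
  rw [add_assoc, Finset.prod_range_add, Finset.prod_range_succ', add_zero, mul_pow, ← mul_assoc]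
  refine mul_le_mul ?_ ?_ (by positivity) (by positivity)
  · calc ((p : ℝ)⁻¹) ^ (j + (m + 1)) ≤ ((p : ℝ)⁻¹) ^ (j + m) :=
          pow_le_pow_of_le_one (by positivity) hp1 (by omega)
      _ ≤ _ := inv_pow_le_prod_norm_natCast_sub p j m
      _ ≤ _ := mul_le_mul hleft hright (Finset.prod_nonneg fun _ _ => norm_nonneg _)
          (Finset.prod_nonneg fun _ _ => norm_nonneg _)
  · exact (pow_le_pow_of_le_one hD.le hD1 (by omega)).trans (hα j)

theorem Multiset.exists_pow_le_prod_norm_natCast_sub (s : Multiset K)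
    (hs : ∀ α ∈ s, ∃ E : ℝ, 0 < E ∧ ∀ n : ℕ, E ^ n ≤ ∏ k ∈ Finset.range n, ‖(k : K) - α‖) :
    ∃ E : ℝ, 0 < E ∧ ∀ n : ℕ,
      E ^ n ≤ ∏ k ∈ Finset.range n, ‖(s.map fun α => (k : K) - α).prod‖ := by
  induction s using Multiset.induction_on with
  | empty => exact ⟨1, one_pos, fun n => by simp⟩
  | cons a s ih =>
    obtain ⟨A, hA, hA'⟩ := hs a (Multiset.mem_cons_self a s)
    obtain ⟨B, hB, hB'⟩ := ih fun α hα => hs α (Multiset.mem_cons_of_mem hα)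
    refine ⟨A * B, by positivity, fun n => ?_⟩
    simp only [Multiset.map_cons, Multiset.prod_cons, norm_mul, Finset.prod_mul_distrib, mul_pow]
    exact mul_le_mul (hA' n) (hB' n) (by positivity)
      (Finset.prod_nonneg fun _ _ => norm_nonneg _)

end Ultrametric

theorem Polynomial.exists_pow_le_norm_prod_eval_natCast {p : ℕ} [Fact p.Prime] {f : Polynomial ℤ}
    (hf : ∀ k : ℕ, f.eval (k : ℤ) ≠ 0) :
    ∃ E : ℝ, 0 < E ∧ ∀ n : ℕ,
      E ^ n ≤ ‖((∏ k ∈ Finset.range n, f.eval (k : ℤ) : ℤ) : ℚ_[p])‖ := by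
  let K := PadicAlgCl p
  let F : Polynomial K := f.map (Int.castRingHom K)
  have hF : F ≠ 0 := by
    rw [Polynomial.map_ne_zero_iff (RingHom.injective_int _)]
    rintro rfl
    exact hf 0 Polynomial.eval_zero
  obtain ⟨E, hE, hEn⟩ := F.roots.exists_pow_le_prod_norm_natCast_sub fun α hα => by
    obtain ⟨D, hD, hD1, hDk⟩ :=
      exists_pow_le_norm_natCast_sub_root p hf (Polynomial.isRoot_of_mem_roots hα)
    exact exists_pow_le_prod_norm_natCast_sub p hD hD1 hDk
  have hc : 0 < ‖F.leadingCoeff‖ := norm_pos_iff.mpr (Polynomial.leadingCoeff_ne_zero.mpr hF)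
  refine ⟨‖F.leadingCoeff‖ * E, by positivity, fun n => ?_⟩
  have heval : ∀ k : ℕ, ((f.eval (k : ℤ) : ℤ) : K)
      = F.leadingCoeff * (F.roots.map fun α => (k : K) - α).prod := fun k => by
    rw [← (IsAlgClosed.splits F).eval_eq_prod_roots, Polynomial.eval_natCast_map, eq_intCast]
  rw [← Padic.norm_intCast_eq_norm_algebra K, Int.cast_prod, norm_prod]
  simp only [heval, norm_mul, Finset.prod_mul_distrib, Finset.prod_const, Finset.card_range,
    mul_pow]
  gcongr
  exact hEn n

/-- Lemma 3.2: let `f(z) ∈ ℤ[z]` with `f(k) ≠ 0` for every nonnegative integer `k`.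
Then for every prime `p` there is a positive constant `C` (depending on `f` and `p`)
such that `v_p(∏_{k=0}^{n−1} f(k)) ≤ C·n` for all positive integers `n`. -/
theorem stmt15 (f : Polynomial ℤ) (hf : ∀ k : ℕ, f.eval (k : ℤ) ≠ 0)
    (p : ℕ) (hp : p.Prime) :
    ∃ C : ℝ, 0 < C ∧ ∀ n : ℕ, 0 < n →
      ((padicValInt p (∏ k ∈ Finset.range n, f.eval (k : ℤ)) : ℝ)) ≤ C * n := by
  have : Fact p.Prime := ⟨hp⟩
  obtain ⟨E, hE, hEn⟩ := Polynomial.exists_pow_le_norm_prod_eval_natCast (p := p) hf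
  have hp0 : (0 : ℝ) < (p : ℝ)⁻¹ := inv_pos.mpr (by exact_mod_cast hp.pos)
  have hp1 : (p : ℝ)⁻¹ < 1 := inv_lt_one_of_one_lt₀ (by exact_mod_cast hp.one_lt)
  obtain ⟨m, hm⟩ := exists_pow_lt_of_lt_one hE hp1
  refine ⟨m + 1, by positivity, fun n _ => ?_⟩
  have h := (pow_le_pow_left₀ (by positivity) hm.le n).trans (hEn n)
  rw [Padic.norm_intCast_eq_pow_padicValInt (Finset.prod_ne_zero_iff.mpr fun k _ => hf k),
    ← pow_mul, pow_le_pow_iff_right_of_lt_one₀ hp0 hp1] at h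
  exact_mod_cast h.trans (Nat.mul_le_mul_right n m.le_succ)
end

section
/- Let f(z) = Az² + Bz + C ∈ ℤ[z] with A > 0 and gcd(A,B,C) = 1, and suppose D = B² − 4AC is not a perfect square in ℤ. Let M and N be positive integers and let r be an integer with 0 ≤ r ≤ N. If p is a prime and v, l are positive integers satisfying gcd(p, 4AND) = 1, v ≤ p^l, f(v) ≡ 0 (mod p^l), and p^l > 4AN²(A(M+N)² + |B|(M+N) + |C|), then |r/N − v/p^l| > M/p^l. -/
/-- A binary quadratic form with a zero `(s, n)`, `n ≠ 0`, has square discriminant. -/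
theorem isSquare_discrim_of_form_eq_zero {A B C s n : ℤ} (hn : n ≠ 0)
    (h : A * s ^ 2 + B * n * s + C * n ^ 2 = 0) : IsSquare (B ^ 2 - 4 * A * C) := by
  have key : (2 * A * s + B * n) ^ 2 = n ^ 2 * (B ^ 2 - 4 * A * C) := by
    linear_combination 4 * A * h
  obtain ⟨k, hk⟩ := (Int.pow_dvd_pow_iff two_ne_zero).1 (Dvd.intro _ key.symm)
  refine ⟨k, mul_left_cancel₀ (pow_ne_zero 2 hn) ?_⟩
  rw [← key, hk]
  ring

/-- Size bound for a binary quadratic form at `(s, n)` when `|s| ≤ m * n`. -/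
theorem abs_form_le {A B C s n m : ℤ} (hA : 0 ≤ A) (hn : 0 ≤ n) (hs : |s| ≤ m * n) :
    |A * s ^ 2 + B * n * s + C * n ^ 2| ≤ n ^ 2 * (A * m ^ 2 + |B| * m + |C|) :=
  calc |A * s ^ 2 + B * n * s + C * n ^ 2|
      ≤ |A * s ^ 2| + |B * n * s| + |C * n ^ 2| := abs_add_three _ _ _
    _ = A * |s| ^ 2 + |B| * n * |s| + |C| * n ^ 2 := by
      simp only [abs_mul, abs_pow, abs_of_nonneg hA, abs_of_nonneg hn]
    _ ≤ A * (m * n) ^ 2 + |B| * n * (m * n) + |C| * n ^ 2 := by gcongr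
    _ = n ^ 2 * (A * m ^ 2 + |B| * m + |C|) := by ring

/-- Lemma 4.2: let `f(z) = Az² + Bz + C ∈ ℤ[z]` be primitive with `A > 0` and
`D = B² − 4AC` not a perfect square. Let `M, N` be positive integers and `0 ≤ r ≤ N`.
If `p` is a prime and `v, l` positive integers with `gcd(p, 4AND) = 1`, `v ≤ p^l`,
`f(v) ≡ 0 (mod p^l)` and `p^l > 4AN²(A(M+N)² + |B|(M+N) + |C|)`, then
`|r/N − v/p^l| > M/p^l`. -/
theorem stmt17 (A B C : ℤ) (hA : 0 < A) (hprim : Int.gcd (Int.gcd A B) C = 1)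
    (hD : ¬ IsSquare (B ^ 2 - 4 * A * C))
    (M N : ℕ) (hM : 0 < M) (hN : 0 < N)
    (r : ℤ) (hr0 : 0 ≤ r) (hrN : r ≤ (N : ℤ))
    (p : ℕ) (hp : p.Prime) (v l : ℕ) (hv : 0 < v) (hl : 0 < l)
    (hcop : Int.gcd (p : ℤ) (4 * A * (N : ℤ) * (B ^ 2 - 4 * A * C)) = 1)
    (hvp : v ≤ p ^ l)
    (hdvd : (p : ℤ) ^ l ∣ (A * (v : ℤ) ^ 2 + B * (v : ℤ) + C))
    (hbig : (p : ℤ) ^ l >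
      4 * A * (N : ℤ) ^ 2 * (A * ((M : ℤ) + N) ^ 2 + |B| * ((M : ℤ) + N) + |C|)) :
    |(r : ℚ) / (N : ℚ) - (v : ℚ) / (p : ℚ) ^ l| > (M : ℚ) / (p : ℚ) ^ l := by
  by_contra! hle
  have hq : 0 < (p : ℤ) ^ l := by have := hp.pos; positivity
  have hNz : (0 : ℤ) < N := by exact_mod_cast hN
  have hs : |(v : ℤ) * N - r * (p : ℤ) ^ l| ≤ M * N := by
    have hqQ : (0 : ℚ) < (p : ℚ) ^ l := by exact_mod_cast hq
    have hNQ : (0 : ℚ) < N := by exact_mod_cast hN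
    rw [div_sub_div _ _ hNQ.ne' hqQ.ne', abs_div, abs_of_pos (mul_pos hNQ hqQ),
      div_le_div_iff₀ (mul_pos hNQ hqQ) hqQ, ← mul_assoc] at hle
    have h := le_of_mul_le_mul_right hle hqQ
    rw [abs_sub_comm, mul_comm (N : ℚ)] at h
    exact_mod_cast h
  set s : ℤ := (v : ℤ) * N - r * (p : ℤ) ^ l with hs_def
  have hdvd' : (p : ℤ) ^ l ∣ A * s ^ 2 + B * N * s + C * (N : ℤ) ^ 2 := by
    have h : A * s ^ 2 + B * N * s + C * (N : ℤ) ^ 2 =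
        (A * (v : ℤ) ^ 2 + B * v + C) * (N : ℤ) ^ 2 +
          (p : ℤ) ^ l * (A * r * (r * (p : ℤ) ^ l - 2 * v * N) - B * N * r) := by
      rw [hs_def]; ring
    rw [h]
    exact dvd_add (hdvd.mul_right _) (dvd_mul_right _ _)
  refine hD (isSquare_discrim_of_form_eq_zero hNz.ne'
    (Int.eq_zero_of_abs_lt_dvd hdvd' (lt_of_le_of_lt ?_ hbig)))
  calc |A * s ^ 2 + B * N * s + C * (N : ℤ) ^ 2|
      ≤ (N : ℤ) ^ 2 * (A * (M : ℤ) ^ 2 + |B| * M + |C|) := abs_form_le hA.le hNz.le hs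
    _ ≤ 4 * A * (N : ℤ) ^ 2 * (A * ((M : ℤ) + N) ^ 2 + |B| * ((M : ℤ) + N) + |C|) := by
      gcongr
      · exact le_mul_of_one_le_left (by positivity) (by linarith)
      · exact le_add_of_nonneg_right hNz.le
      · exact le_add_of_nonneg_right hNz.le
end

section
/- Let f(z) = Az² + Bz + C ∈ ℤ[z] with A > 0 and gcd(A,B,C) = 1, and suppose D = B² − 4AC is not a perfect square in ℤ. Let 𝒮 be an arithmetic progression containing infinitely many primes p with Legendre symbol (D/p) = 1. Then: (i) for every integer a with 1 ≤ a ≤ A, S_a(x) := #{v/p : p ∈ 𝒮 prime, p ≤ x, 0 ≤ v < p, f(v) = a·p²} satisfies S_a(x) = o(π(x)) as x → ∞; and (ii) S_𝒴(x) := #{v/p : p ∈ 𝒮 prime, p ≤ x, 0 ≤ v < p, f(v) ≡ 0 (mod p²)} satisfies S_𝒴(x) = o(π(x)) as x → ∞. -/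
open scoped BigOperators

/-- The arithmetic progression of nonnegative integers with first term `b` and
common difference `m`. -/
def progression (b m : ℕ) : Set ℕ := {n : ℕ | ∃ k : ℕ, n = b + k * m}

open Filter Asymptotics in
/-- The square root is dominated by the prime counting function. -/
lemma eventually_sqrt_le_primeCounting :
    ∀ᶠ x : ℕ in atTop, √(x : ℝ) ≤ (Nat.primeCounting x : ℝ) := by
  have hlog : ∀ᶠ x : ℝ in atTop, ‖Real.log x‖ ≤ 1 / 4 * ‖x ^ (1 / 2 : ℝ)‖ :=
    (isLittleO_log_rpow_atTop (by norm_num)).bound (by norm_num)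
  filter_upwards [tendsto_natCast_atTop_atTop.eventually hlog, eventually_ge_atTop 4]
    with x hx h4
  have h4' : (4 : ℝ) ≤ x := by exact_mod_cast h4
  have hpos : 0 < Real.log x := Real.log_pos (by linarith)
  rw [← Real.sqrt_eq_rpow, Real.norm_of_nonneg hpos.le,
    Real.norm_of_nonneg (Real.sqrt_nonneg _)] at hx
  refine le_trans ?_ (Chebyshev.pi_ge x)
  rw [le_div_iff₀ hpos]
  have hs : √(x : ℝ) * √(x : ℝ) = x := Real.mul_self_sqrt (by linarith)
  have hs2 : 2 ≤ √(x : ℝ) := Real.le_sqrt_of_sq_le (by linarith)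
  have hlog1 : Real.log (x + 1) ≤ 2 * Real.log x := by
    rw [← Real.log_rpow (by linarith)]
    apply Real.log_le_log (by linarith)
    norm_num
    nlinarith
  have hl2 := Real.log_two_gt_d9
  nlinarith

/-- Two points of the hyperbola `X² = N Y² + D` whose ordinates are within a factor of two
of each other span a lattice triangle of bounded area. -/
lemma abs_cross_le_of_sq_eq {N D X Y X' Y' : ℤ} (h : X ^ 2 = N * Y ^ 2 + D)
    (h' : X' ^ 2 = N * Y' ^ 2 + D) (hY : 0 < Y) (hY' : 0 < Y') (hX : Y ≤ X) (hX' : Y' ≤ X')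
    (h₁ : Y' ≤ 2 * Y) (h₂ : Y ≤ 2 * Y') : |X * Y' - X' * Y| ≤ |D| := by
  have hYY : 0 < Y * Y' := mul_pos hY hY'
  have hs : 2 * (Y * Y') ≤ X * Y' + X' * Y := by nlinarith
  have key : (X * Y' - X' * Y) * (X * Y' + X' * Y) = D * (Y' ^ 2 - Y ^ 2) := by
    linear_combination Y' ^ 2 * h - Y ^ 2 * h'
  have habs : |X * Y' - X' * Y| * (X * Y' + X' * Y) = |D| * |Y' ^ 2 - Y ^ 2| := by
    rw [← abs_mul, ← key, abs_mul, abs_of_pos (by linarith : 0 < X * Y' + X' * Y)]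
  have hsq : |Y' ^ 2 - Y ^ 2| ≤ X * Y' + X' * Y := by
    rw [abs_le]
    constructor <;> nlinarith
  have hle := mul_le_mul_of_nonneg_left hsq (abs_nonneg D)
  rw [← habs] at hle
  exact le_of_mul_le_mul_right hle (by linarith)

/-- The pairs `(p, v)` with `p < M` prime, `v < p` and `f(v) ≡ 0 (mod p²)`. -/
def rootPairs (A B C : ℤ) (M : ℕ) : Set (ℕ × ℕ) :=
  {z | z.1.Prime ∧ z.1 < M ∧ z.2 < z.1 ∧
    (z.1 : ℤ) ^ 2 ∣ A * (z.2 : ℤ) ^ 2 + B * (z.2 : ℤ) + C}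

/-- The pairs `(p, v)` with `M ≤ p < 2M` prime, `v < p` and `f(v) = a p²`. -/
def dyadicPairs (A B C a : ℤ) (M : ℕ) : Set (ℕ × ℕ) :=
  {z | z.1.Prime ∧ M ≤ z.1 ∧ z.1 < 2 * M ∧ z.2 < z.1 ∧
    A * (z.2 : ℤ) ^ 2 + B * (z.2 : ℤ) + C = a * (z.1 : ℤ) ^ 2}

lemma finite_rootPairs (A B C : ℤ) (M : ℕ) : (rootPairs A B C M).Finite := by
  refine ((Set.finite_Iio M).prod (Set.finite_Iio M)).subset ?_
  rintro ⟨p, v⟩ ⟨-, h1, h2, -⟩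
  exact ⟨h1, lt_trans h2 h1⟩

lemma ncard_rootPairs_mono (A B C : ℤ) : Monotone fun M => (rootPairs A B C M).ncard :=
  fun _ M h => Set.ncard_le_ncard (fun _ hz => ⟨hz.1, hz.2.1.trans_le h, hz.2.2⟩)
    (finite_rootPairs A B C M)

lemma ncard_dyadicPairs_le {A B C a : ℤ} (hA : 0 < A) (ha : 1 ≤ a)
    (hD : B ^ 2 - 4 * A * C ≠ 0) {M : ℕ}
    (hM : |B| + |B ^ 2 - 4 * A * C| < M) :
    (dyadicPairs A B C a M).ncard ≤ 2 * (B ^ 2 - 4 * A * C).natAbs + 1 := by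
  set D := B ^ 2 - 4 * A * C with hDdef
  have hB0 := abs_nonneg B
  have hD0 := abs_nonneg D
  have hyp : ∀ z ∈ dyadicPairs A B C a M,
      (2 * A * (z.2 : ℤ) + B) ^ 2 = 4 * A * a * (z.1 : ℤ) ^ 2 + D := by
    rintro z ⟨-, -, -, -, hz⟩
    linear_combination 4 * A * hz
  have hlow : ∀ z ∈ dyadicPairs A B C a M, (z.1 : ℤ) ≤ 2 * A * (z.2 : ℤ) + B := by
    intro z hz
    have h := hyp z hz
    have hMp : (M : ℤ) ≤ z.1 := by exact_mod_cast hz.2.1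
    have hAa : 1 ≤ A * a := by nlinarith
    have hv : 0 ≤ A * (z.2 : ℤ) := by positivity
    have hDl := neg_abs_le D
    have hBl := neg_abs_le B
    by_contra! hlt
    have hsq : (2 * A * (z.2 : ℤ) + B) ^ 2 < (z.1 : ℤ) ^ 2 :=
      sq_lt_sq' (by linarith) hlt
    nlinarith [mul_le_mul_of_nonneg_right hAa (sq_nonneg (z.1 : ℤ))]
  rcases (dyadicPairs A B C a M).eq_empty_or_nonempty with he | ⟨⟨p, v⟩, hz⟩
  · simp [he]
  have hcard : (Set.Icc (-|D|) |D|).ncard = 2 * D.natAbs + 1 := by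
    rw [← Finset.coe_Icc, Set.ncard_coe_finset, Int.card_Icc, Int.abs_eq_natAbs]
    omega
  rw [← hcard]
  refine Set.ncard_le_ncard_of_injOn
    (fun z => (2 * A * (v : ℤ) + B) * (z.1 : ℤ) - (2 * A * (z.2 : ℤ) + B) * (p : ℤ))
    ?_ ?_ (Set.finite_Icc _ _)
  · intro z hz'
    have h1 := hz.1.pos
    have h2 := hz'.1.pos
    have h3 := hz.2.1
    have h4 := hz.2.2.1
    have h5 := hz'.2.1
    have h6 := hz'.2.2.1
    rw [Set.mem_Icc, ← abs_le]
    exact abs_cross_le_of_sq_eq (hyp _ hz) (hyp z hz') (by exact_mod_cast h1)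
      (by exact_mod_cast h2) (hlow _ hz) (hlow z hz') (by dsimp only at *; omega)
      (by dsimp only at *; omega)
  · intro z hz₁ z' hz₂ heq
    dsimp only at heq
    have hp : Prime (p : ℤ) := Nat.prime_iff_prime_int.mp hz.1
    have hMp : (M : ℤ) ≤ p := by exact_mod_cast hz.2.1
    have hX : ¬ (p : ℤ) ∣ 2 * A * (v : ℤ) + B := by
      intro hdvd
      have hpD : (p : ℤ) ∣ D := by
        have h := hyp _ hz
        dsimp only at h
        rw [show D = (2 * A * (v : ℤ) + B) ^ 2 - 4 * A * a * (p : ℤ) ^ 2 by linarith]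
        exact dvd_sub (dvd_pow hdvd two_ne_zero)
          (Dvd.dvd.mul_left (dvd_pow_self _ two_ne_zero) _)
      exact hD (Int.eq_zero_of_abs_lt_dvd hpD (by linarith))
    have hdvd : (p : ℤ) ∣ (2 * A * (v : ℤ) + B) * ((z.1 : ℤ) - z'.1) :=
      ⟨2 * A * (z.2 : ℤ) - 2 * A * (z'.2 : ℤ), by linear_combination heq⟩
    have h1 : (z.1 : ℤ) = z'.1 := by
      refine sub_eq_zero.mp (Int.eq_zero_of_abs_lt_dvd
        ((hp.dvd_or_dvd hdvd).resolve_left hX) ?_)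
      obtain ⟨-, h3, h4, -, -⟩ := hz₁
      obtain ⟨-, h5, h6, -, -⟩ := hz₂
      rw [abs_lt]
      omega
    have hp0 : (p : ℤ) ≠ 0 := hp.ne_zero
    rw [h1] at heq
    have h2 : (z.2 : ℤ) = z'.2 := by
      have : (2 * A * (p : ℤ)) * z.2 = (2 * A * (p : ℤ)) * z'.2 := by
        linear_combination -heq
      exact mul_left_cancel₀ (by positivity) this
    exact Prod.ext (by exact_mod_cast h1) (by exact_mod_cast h2)

lemma rootPairs_two_mul_subset {A B C : ℤ} (hA : 0 < A)
    (hD : ¬ IsSquare (B ^ 2 - 4 * A * C)) {M : ℕ} (hM : |B| + |C| < M) :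
    rootPairs A B C (2 * M) ⊆
      rootPairs A B C M ∪ ⋃ a ∈ Finset.Icc 1 A, dyadicPairs A B C a M := by
  rintro ⟨p, v⟩ ⟨hp, hlt, hv, hdvd⟩
  rcases lt_or_ge p M with h | h
  · exact Or.inl ⟨hp, h, hv, hdvd⟩
  right
  obtain ⟨a, ha⟩ := hdvd
  dsimp only at hlt hv ha hp
  have hMp : (M : ℤ) ≤ p := by exact_mod_cast h
  have hvp : (v : ℤ) < p := by exact_mod_cast hv
  have hv0 : (0 : ℤ) ≤ v := by positivity
  have hB0 := abs_nonneg B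
  have hC0 := abs_nonneg C
  have hp2 : |B| * p + |C| < (p : ℤ) ^ 2 := by nlinarith
  have hBv : |B * v| ≤ |B| * p := by
    rw [abs_mul, abs_of_nonneg hv0]
    exact mul_le_mul_of_nonneg_left hvp.le hB0
  have hBv' := abs_le.mp hBv
  have hC' := abs_le.mp (le_refl |C|)
  have hpos : 0 < (p : ℤ) ^ 2 := by nlinarith
  have hv2 : (v : ℤ) ^ 2 ≤ (p : ℤ) ^ 2 := by nlinarith
  have hAv : A * (v : ℤ) ^ 2 ≤ A * (p : ℤ) ^ 2 := mul_le_mul_of_nonneg_left hv2 hA.le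
  have hAv0 : 0 ≤ A * (v : ℤ) ^ 2 := by positivity
  have hup : a < A + 1 := by
    refine lt_of_mul_lt_mul_left (a := (p : ℤ) ^ 2) ?_ hpos.le
    linarith
  have hlo : -1 < a := by
    refine lt_of_mul_lt_mul_left (a := (p : ℤ) ^ 2) ?_ hpos.le
    linarith
  have hne : a ≠ 0 := by
    rintro rfl
    exact hD ⟨2 * A * v + B, by linear_combination -4 * A * ha⟩
  simp only [Set.mem_iUnion]
  exact ⟨a, Finset.mem_Icc.mpr ⟨by omega, by omega⟩, hp, h, hlt, hv, by rw [ha, mul_comm]⟩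

lemma ncard_rootPairs_two_mul_le {A B C : ℤ} (hA : 0 < A)
    (hD : ¬ IsSquare (B ^ 2 - 4 * A * C)) {M : ℕ}
    (hM : |B| + |C| + |B ^ 2 - 4 * A * C| < M) :
    (rootPairs A B C (2 * M)).ncard ≤
      (rootPairs A B C M).ncard + A.toNat * (2 * (B ^ 2 - 4 * A * C).natAbs + 1) := by
  have hC0 := abs_nonneg C
  have hD0 := abs_nonneg (B ^ 2 - 4 * A * C)
  have hfin : (⋃ a ∈ Finset.Icc 1 A, dyadicPairs A B C a M).Finite := by
    refine ((Set.finite_Iio (2 * M)).prod (Set.finite_Iio (2 * M))).subset ?_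
    simp only [Set.iUnion_subset_iff]
    rintro a - ⟨p, v⟩ ⟨-, -, h1, h2, -⟩
    exact ⟨h1, lt_trans h2 h1⟩
  refine (Set.ncard_le_ncard (rootPairs_two_mul_subset hA hD (by linarith))
    ((finite_rootPairs A B C M).union hfin)).trans ((Set.ncard_union_le _ _).trans ?_)
  gcongr
  refine (Finset.set_ncard_biUnion_le _ _).trans ?_
  refine (Finset.sum_le_card_nsmul _ _ _ fun a ha => ncard_dyadicPairs_le hA
    (Finset.mem_Icc.mp ha).1 (fun h => hD (h ▸ IsSquare.zero)) (by linarith)).trans ?_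
  simp

lemma exists_ncard_rootPairs_two_pow_le {A B C : ℤ} (hA : 0 < A)
    (hD : ¬ IsSquare (B ^ 2 - 4 * A * C)) :
    ∃ c K : ℕ, ∀ k : ℕ, (rootPairs A B C (2 ^ k)).ncard ≤ c + k * K := by
  obtain ⟨k₀, hk₀⟩ : ∃ k₀ : ℕ, |B| + |C| + |B ^ 2 - 4 * A * C| < ((2 ^ k₀ : ℕ) : ℤ) := by
    refine ⟨(|B| + |C| + |B ^ 2 - 4 * A * C|).toNat, ?_⟩
    have := Nat.lt_two_pow_self (n := (|B| + |C| + |B ^ 2 - 4 * A * C|).toNat)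
    omega
  refine ⟨(rootPairs A B C (2 ^ k₀)).ncard,
    A.toNat * (2 * (B ^ 2 - 4 * A * C).natAbs + 1), fun k => ?_⟩
  induction k with
  | zero =>
    exact le_add_right (ncard_rootPairs_mono A B C (Nat.pow_le_pow_right two_pos k₀.zero_le))
  | succ k ih =>
    rcases lt_or_ge k k₀ with h | h
    · exact le_add_right (ncard_rootPairs_mono A B C (Nat.pow_le_pow_right two_pos h))
    · have hle : ((2 ^ k₀ : ℕ) : ℤ) ≤ ((2 ^ k : ℕ) : ℤ) := by
        exact_mod_cast Nat.pow_le_pow_right two_pos h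
      have := ncard_rootPairs_two_mul_le hA hD (hk₀.trans_le hle)
      rw [pow_succ, mul_comm (2 ^ k) 2]
      linarith

open Filter Asymptotics in
/-- The number of pairs `(p, v)` with `p ≤ x` prime, `v < p` and `f(v) ≡ 0 (mod p²)` is
`o(π(x))`. -/
lemma tendsto_ncard_rootPairs_div_primeCounting {A B C : ℤ} (hA : 0 < A)
    (hD : ¬ IsSquare (B ^ 2 - 4 * A * C)) :
    Tendsto (fun x : ℕ => ((rootPairs A B C (x + 1)).ncard : ℝ) / (Nat.primeCounting x : ℝ))
      atTop (nhds 0) := by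
  obtain ⟨c, K, hcK⟩ := exists_ncard_rootPairs_two_pow_le hA hD
  have hbound : ∀ x : ℕ, x ≠ 0 → ((rootPairs A B C (x + 1)).ncard : ℝ) ≤
      c + K + K / Real.log 2 * Real.log x := by
    intro x hx
    have h1 : (rootPairs A B C (x + 1)).ncard ≤ c + (Nat.log 2 x + 1) * K :=
      (ncard_rootPairs_mono A B C (Nat.lt_pow_succ_log_self one_lt_two x)).trans (hcK _)
    have h2 : (Nat.log 2 x : ℝ) ≤ Real.log x / Real.log 2 := by
      simpa [Real.logb] using Real.natLog_le_logb x 2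
    have h3 : ((rootPairs A B C (x + 1)).ncard : ℝ) ≤ c + (Nat.log 2 x + 1) * K := by
      exact_mod_cast h1
    have h4 := mul_le_mul_of_nonneg_right h2 (Nat.cast_nonneg (α := ℝ) K)
    calc _ ≤ _ := h3
      _ ≤ c + K + Real.log x / Real.log 2 * K := by linarith
      _ = _ := by ring
  have hlog : Tendsto (fun x : ℝ => (c + K + K / Real.log 2 * Real.log x) / √x)
      atTop (nhds 0) := by
    have h1 : Tendsto (fun x : ℝ => ((c : ℝ) + K) / √x) atTop (nhds 0) :=
      Real.tendsto_sqrt_atTop.const_div_atTop _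
    have h2 : Tendsto (fun x : ℝ => Real.log x / √x) atTop (nhds 0) := by
      simpa only [Real.sqrt_eq_rpow] using
        (isLittleO_log_rpow_atTop (r := 1 / 2) (by norm_num)).tendsto_div_nhds_zero
    have h3 := h1.add (h2.const_mul ((K : ℝ) / Real.log 2))
    rw [mul_zero, add_zero] at h3
    refine h3.congr fun x => ?_
    rw [add_div _ (_ * _), mul_div_assoc]
  refine squeeze_zero' (Eventually.of_forall fun x => by positivity) ?_
    (hlog.comp tendsto_natCast_atTop_atTop)
  filter_upwards [eventually_sqrt_le_primeCounting, eventually_ge_atTop 1] with x hx h1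
  have hb := hbound x (by omega)
  have hs : 0 < √(x : ℝ) := Real.sqrt_pos.mpr (by exact_mod_cast h1)
  exact div_le_div₀ ((Nat.cast_nonneg _).trans hb) hb hs hx

/-- Lemma 4.4: let `f(z) = Az² + Bz + C` be a primitive integer quadratic with `A > 0`
whose discriminant `D = B² − 4AC` is not a perfect square, and let `𝒮` be an arithmetic
progression containing infinitely many primes `p` with `(D/p) = 1`. Then
(i) for each `1 ≤ a ≤ A`, `S_a(x) = #{v/p : p ∈ 𝒮 prime, p ≤ x, 0 ≤ v < p, f(v) = a p²}`
is `o(π(x))`; and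
(ii) `S_𝒴(x) = #{v/p : p ∈ 𝒮 prime, p ≤ x, 0 ≤ v < p, p² ∣ f(v)}` is `o(π(x))`. -/
theorem stmt18 (A B C : ℤ) (hA : 0 < A) (hprim : Int.gcd (Int.gcd A B) C = 1)
    (hD : ¬ IsSquare (B ^ 2 - 4 * A * C))
    (b m : ℕ)
    (hinf : {p : ℕ | ∃ hp : p.Prime, p ∈ progression b m ∧
      @legendreSym p ⟨hp⟩ (B ^ 2 - 4 * A * C) = 1}.Infinite) :
    (∀ a : ℤ, 1 ≤ a → a ≤ A →
      Filter.Tendsto (fun x : ℕ =>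
        ((Set.ncard {q : ℚ | ∃ p v : ℕ, p.Prime ∧ p ∈ progression b m ∧ p ≤ x ∧ v < p ∧
            A * (v : ℤ) ^ 2 + B * (v : ℤ) + C = a * (p : ℤ) ^ 2 ∧
            q = (v : ℚ) / (p : ℚ)} : ℝ) / (Nat.primeCounting x : ℝ)))
        Filter.atTop (nhds 0)) ∧
    Filter.Tendsto (fun x : ℕ =>
      ((Set.ncard {q : ℚ | ∃ p v : ℕ, p.Prime ∧ p ∈ progression b m ∧ p ≤ x ∧ v < p ∧
          (p : ℤ) ^ 2 ∣ (A * (v : ℤ) ^ 2 + B * (v : ℤ) + C) ∧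
          q = (v : ℚ) / (p : ℚ)} : ℝ) / (Nat.primeCounting x : ℝ)))
      Filter.atTop (nhds 0) := by
  have key : ∀ s : ℕ → Set ℚ,
      (∀ x, s x ⊆ (fun z : ℕ × ℕ => (z.2 : ℚ) / (z.1 : ℚ)) '' rootPairs A B C (x + 1)) →
      Filter.Tendsto (fun x => ((s x).ncard : ℝ) / (Nat.primeCounting x : ℝ))
        Filter.atTop (nhds 0) := by
    intro s hs
    refine squeeze_zero (fun x => by positivity) (fun x => ?_)
      (tendsto_ncard_rootPairs_div_primeCounting hA hD)
    have hfin := finite_rootPairs A B C (x + 1)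
    gcongr
    exact (Set.ncard_le_ncard (hs x) (hfin.image _)).trans (Set.ncard_image_le hfin)
  refine ⟨fun a _ _ => key _ ?_, key _ ?_⟩
  · rintro x q ⟨p, v, hp, -, hpx, hv, hf, rfl⟩
    exact ⟨(p, v), ⟨hp, Nat.lt_succ_of_le hpx, hv, hf ▸ Dvd.intro_left a rfl⟩, rfl⟩
  · rintro x q ⟨p, v, hp, -, hpx, hv, hf, rfl⟩
    exact ⟨(p, v), ⟨hp, Nat.lt_succ_of_le hpx, hv, hf⟩, rfl⟩
end

section
/- Let f(z) = Az² + Bz + C ∈ ℤ[z] with A > 0 and gcd(A,B,C) = 1, suppose D = B² − 4AC is not a perfect square in ℤ, and let 𝒮 be an arithmetic progression containing infinitely many primes p with Legendre symbol (D/p) = 1. Then for every integer a with 1 ≤ a ≤ A, T_a(x) := #{primes p ≤ x : p ∈ 𝒮 and there exists a positive integer n with f(n) = a·p²} satisfies T_a(x) = o(π(x)) as x → ∞. -/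
open scoped BigOperators

/-- Two solutions of the generalized Pell equation `X² = N Y² + D` which are congruent
modulo `D` have second coordinates that differ by a factor of at least `2`. -/
theorem two_mul_le_of_pell_congr {N D X₁ Y₁ X₂ Y₂ : ℤ} (hN : 4 ≤ N) (hD : D ≠ 0)
    (hX₁ : 0 ≤ X₁) (hX₂ : 0 ≤ X₂) (h₁ : X₁ ^ 2 = N * Y₁ ^ 2 + D) (h₂ : X₂ ^ 2 = N * Y₂ ^ 2 + D)
    (hY₁ : |D| < Y₁) (hY : Y₁ < Y₂) (hX : D ∣ X₂ - X₁) (hYY : D ∣ Y₂ - Y₁) :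
    2 * Y₁ ≤ Y₂ := by
  have hDpos : 0 ≤ |D| := abs_nonneg D
  have hle : ∀ X Y : ℤ, 0 ≤ X → |D| < Y → X ^ 2 = N * Y ^ 2 + D → Y ≤ X := by
    intro X Y hX hY h
    have hD' : -|D| ≤ D := neg_abs_le D
    refine le_of_sq_le_sq ?_ hX
    nlinarith [sq_nonneg Y]
  have hXY₁ := hle X₁ Y₁ hX₁ hY₁ h₁
  have hXY₂ := hle X₂ Y₂ hX₂ (hY₁.trans hY) h₂
  obtain ⟨k, hk⟩ : D ∣ X₁ * Y₂ - X₂ * Y₁ := by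
    have : X₁ * Y₂ - X₂ * Y₁ = (Y₂ - Y₁) * X₁ - (X₂ - X₁) * Y₁ := by ring
    rw [this]
    exact dvd_sub (hYY.mul_right _) (hX.mul_right _)
  have hprod : k * (X₁ * Y₂ + X₂ * Y₁) = Y₂ ^ 2 - Y₁ ^ 2 := by
    apply mul_left_cancel₀ hD
    linear_combination (-(X₁ * Y₂ + X₂ * Y₁)) * hk + Y₂ ^ 2 * h₁ - Y₁ ^ 2 * h₂
  have hY₁pos : 0 < Y₁ := by linarith
  have hlow : 2 * (Y₁ * Y₂) ≤ X₁ * Y₂ + X₂ * Y₁ := by nlinarith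
  have hYpos : 0 < Y₁ * Y₂ := by nlinarith
  have hkpos : 0 < k := by
    by_contra! hk0
    nlinarith
  have hle' : 2 * (Y₁ * Y₂) ≤ Y₂ ^ 2 - Y₁ ^ 2 := by nlinarith
  nlinarith

open Classical in
/-- The number of `Y ≤ x` occurring in a solution of `X² = N Y² + D` is `O(log x)`. -/
theorem card_pell_le {N D : ℤ} (hN : 4 ≤ N) (hD : D ≠ 0) (x : ℕ) :
    ((Finset.range (x + 1)).filter
      (fun Y : ℕ => ∃ X : ℕ, (X : ℤ) ^ 2 = N * (Y : ℤ) ^ 2 + D)).card ≤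
      (D.natAbs + 1) + D.natAbs * (D.natAbs * (Nat.log 2 x + 1)) := by
  set S := (Finset.range (x + 1)).filter
    (fun Y : ℕ => ∃ X : ℕ, (X : ℤ) ^ 2 = N * (Y : ℤ) ^ 2 + D) with hS
  have hd : 0 < D.natAbs := Int.natAbs_pos.mpr hD
  have hsol : ∀ Y : ℕ, ∃ X : ℕ, Y ∈ S → (X : ℤ) ^ 2 = N * (Y : ℤ) ^ 2 + D := by
    intro Y
    by_cases hY : Y ∈ S
    · obtain ⟨X, hX⟩ := (Finset.mem_filter.mp hY).2
      exact ⟨X, fun _ => hX⟩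
    · exact ⟨0, fun h => absurd h hY⟩
  choose X hX using hsol
  rw [← Finset.card_filter_add_card_filter_not (s := S) (fun Y => Y ≤ D.natAbs)]
  refine add_le_add ?_ ?_
  · calc _ ≤ (Finset.range (D.natAbs + 1)).card := by
          refine Finset.card_le_card fun Y hY => ?_
          have := (Finset.mem_filter.mp hY).2
          exact Finset.mem_range.mpr (by omega)
      _ = _ := Finset.card_range _
  · have hdvd : ∀ {u v : ℕ}, u % D.natAbs = v % D.natAbs → D ∣ (v : ℤ) - u := by
      intro u v h
      rw [← Int.natAbs_dvd]
      exact Nat.modEq_iff_dvd.mp h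
    have hgap : ∀ Y ∈ S, ∀ Z ∈ S, D.natAbs < Y → Y < Z →
        X Y % D.natAbs = X Z % D.natAbs → Y % D.natAbs = Z % D.natAbs →
        Nat.log 2 Y ≠ Nat.log 2 Z := by
      intro Y hY Z hZ hdY hYZ hXmod hYmod hlog
      have h2 : 2 * (Y : ℤ) ≤ Z :=
        two_mul_le_of_pell_congr hN hD (Int.natCast_nonneg (X Y)) (Int.natCast_nonneg (X Z))
          (hX Y hY) (hX Z hZ) (by rw [Int.abs_eq_natAbs]; exact_mod_cast hdY)
          (by exact_mod_cast hYZ) (hdvd hXmod) (hdvd hYmod)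
      have h2' : Y * 2 ≤ Z := by omega
      have := Nat.log_mono_right (b := 2) h2'
      rw [Nat.log_mul_base (by norm_num) (by omega)] at this
      omega
    calc _ ≤ (Finset.range D.natAbs ×ˢ
            (Finset.range D.natAbs ×ˢ Finset.range (Nat.log 2 x + 1))).card := by
          refine Finset.card_le_card_of_injOn
            (fun Y => (X Y % D.natAbs, Y % D.natAbs, Nat.log 2 Y)) ?_ ?_
          · intro Y hY
            have hYx := (Finset.mem_filter.mp (Finset.mem_filter.mp hY).1).1
            have hYx' : Y ≤ x := by
              have := Finset.mem_range.mp hYx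
              omega
            have := Nat.log_mono_right (b := 2) hYx'
            simp only [Finset.coe_product, Set.mem_prod, Finset.mem_coe, Finset.mem_range]
            exact ⟨Nat.mod_lt _ hd, Nat.mod_lt _ hd, by omega⟩
          · intro Y hY Z hZ h
            simp only [Prod.mk.injEq] at h
            obtain ⟨hYS, hYd⟩ := Finset.mem_filter.mp hY
            obtain ⟨hZS, hZd⟩ := Finset.mem_filter.mp hZ
            rcases lt_trichotomy Y Z with hlt | heq | hgt
            · exact absurd h.2.2 (hgap Y hYS Z hZS (by omega) hlt h.1 h.2.1)
            · exact heq
            · exact absurd h.2.2.symm (hgap Z hZS Y hYS (by omega) hgt h.1.symm h.2.1.symm)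
      _ = _ := by simp only [Finset.card_product, Finset.card_range]

open Filter Asymptotics in
/-- `log x = o(π(x))`. -/
theorem tendsto_log_div_primeCounting :
    Tendsto (fun x : ℕ => Real.log x / (Nat.primeCounting x : ℝ)) atTop (nhds 0) := by
  have hsq : Tendsto (fun x : ℕ => 4 * (Real.log x ^ 2 / (x : ℝ))) atTop (nhds 0) := by
    have h := (Real.isLittleO_pow_log_id_atTop (n := 2)).tendsto_div_nhds_zero
    simpa using (h.comp tendsto_natCast_atTop_atTop).const_mul 4
  have hlog : ∀ᶠ x : ℕ in atTop, Real.log x ≤ 1 / 8 * (x : ℝ) := by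
    have h := tendsto_natCast_atTop_atTop (R := ℝ) |>.eventually
      (Real.isLittleO_log_id_atTop.bound (show (0 : ℝ) < 1 / 8 by norm_num))
    filter_upwards [h] with x hx
    have := (le_abs_self _).trans hx
    simpa using this
  refine squeeze_zero' ?_ ?_ hsq
  · exact Eventually.of_forall fun x => div_nonneg (Real.log_natCast_nonneg x) (Nat.cast_nonneg _)
  · filter_upwards [hlog, eventually_ge_atTop 2] with x hx hx2
    have hx2' : (2 : ℝ) ≤ x := by exact_mod_cast hx2
    have hlpos : 0 < Real.log x := Real.log_pos (by linarith)
    have hsucc : Real.log (x + 1) ≤ 2 * Real.log x := by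
      rw [show 2 * Real.log x = Real.log ((x : ℝ) ^ 2) by rw [Real.log_pow]; norm_num]
      exact Real.log_le_log (by linarith) (by nlinarith)
    have hpi := Chebyshev.pi_ge x
    rw [div_le_iff₀ hlpos] at hpi
    have hlower : (x : ℝ) / 4 ≤ Nat.primeCounting x * Real.log x := by
      nlinarith [Real.log_two_gt_d9]
    have hpipos : (0 : ℝ) < Nat.primeCounting x := by
      by_contra! h
      nlinarith
    rw [mul_div_assoc', div_le_div_iff₀ hpipos (by linarith)]
    nlinarith

/-- Corollary 4.5: let `f(z) = Az² + Bz + C` be a primitive integer quadratic with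
`A > 0` whose discriminant `D = B² − 4AC` is not a perfect square, and let `𝒮` be an
arithmetic progression containing infinitely many primes `p` with `(D/p) = 1`. Then for
each `1 ≤ a ≤ A`, `T_a(x) = #{p ≤ x : p ∈ 𝒮 prime, ∃ n > 0, f(n) = a p²}` is `o(π(x))`. -/
theorem stmt19 (A B C : ℤ) (hA : 0 < A) (hprim : Int.gcd (Int.gcd A B) C = 1)
    (hD : ¬ IsSquare (B ^ 2 - 4 * A * C))
    (b m : ℕ)
    (hinf : {p : ℕ | ∃ hp : p.Prime, p ∈ progression b m ∧
      @legendreSym p ⟨hp⟩ (B ^ 2 - 4 * A * C) = 1}.Infinite) :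
    ∀ a : ℤ, 1 ≤ a → a ≤ A →
      Filter.Tendsto (fun x : ℕ =>
        ((Set.ncard {p : ℕ | p.Prime ∧ p ∈ progression b m ∧ p ≤ x ∧
            ∃ n : ℕ, 0 < n ∧ A * (n : ℤ) ^ 2 + B * (n : ℤ) + C = a * (p : ℤ) ^ 2} : ℝ) /
          (Nat.primeCounting x : ℝ)))
        Filter.atTop (nhds 0) := by
  intro a ha _
  classical
  set D : ℤ := B ^ 2 - 4 * A * C with hDdef
  have hD0 : D ≠ 0 := fun h => hD (h ▸ IsSquare.zero)
  have hN : 4 ≤ 4 * A * a := by nlinarith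
  set d : ℕ := D.natAbs
  have hcard : ∀ x : ℕ, Set.ncard {p : ℕ | p.Prime ∧ p ∈ progression b m ∧ p ≤ x ∧
      ∃ n : ℕ, 0 < n ∧ A * (n : ℤ) ^ 2 + B * (n : ℤ) + C = a * (p : ℤ) ^ 2} ≤
      (d + 1) + d * (d * (Nat.log 2 x + 1)) := by
    intro x
    refine le_trans ?_ (card_pell_le hN hD0 x)
    rw [← Set.ncard_coe_finset]
    refine Set.ncard_le_ncard ?_ (Finset.finite_toSet _)
    rintro p ⟨-, -, hpx, n, -, hn⟩
    simp only [Finset.coe_filter, Finset.mem_range, Set.mem_ofPred_eq]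
    refine ⟨by omega, (2 * A * n + B).natAbs, ?_⟩
    rw [Int.natAbs_sq]
    linear_combination 4 * A * hn
  set K : ℝ := (d + 1) + d * (d * (1 / Real.log 2 + 1)) with hK
  have hlim := tendsto_log_div_primeCounting.const_mul K
  rw [mul_zero] at hlim
  refine squeeze_zero' ?_ ?_ hlim
  · exact Filter.Eventually.of_forall fun x => by positivity
  · filter_upwards [Filter.eventually_ge_atTop 3] with x hx
    rw [mul_div_assoc']
    refine div_le_div_of_nonneg_right ?_ (Nat.cast_nonneg _)
    have hx' : (3 : ℝ) ≤ x := by exact_mod_cast hx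
    have hlog1 : 1 ≤ Real.log x := by
      rw [Real.le_log_iff_exp_le (by linarith)]
      linarith [Real.exp_one_lt_d9]
    have hlog2 : (Nat.log 2 x : ℝ) ≤ 1 / Real.log 2 * Real.log x := by
      have := Real.natLog_le_logb x 2
      rw [Real.logb] at this
      calc (Nat.log 2 x : ℝ) ≤ Real.log x / Real.log 2 := by exact_mod_cast this
        _ = _ := by ring
    calc _ ≤ (((d + 1) + d * (d * (Nat.log 2 x + 1)) : ℕ) : ℝ) := by exact_mod_cast hcard x
      _ = (d + 1) * 1 + d * (d * ((Nat.log 2 x : ℝ) + 1)) := by push_cast; ring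
      _ ≤ (d + 1) * Real.log x + d * (d * (1 / Real.log 2 * Real.log x + Real.log x)) := by
          gcongr
      _ = K * Real.log x := by rw [hK]; ring
end
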